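/- arXiv:2410.01656 — 13 statements merged into one kernel-verified Lean document; each statement's English description precedes it below -/
import Mathlib

section
/- Under the positive-unlabeled learning setup, suppose C ≥ 1, 0 < ρ < 1/(3C), and U(T) ≥ e^{−C}·Q(T)^C for every Borel set T ⊆ ℝ^d. Then for every Borel set S ⊆ ℝ^d, writing S_OPT := P ∖ B_{1/2}, one has Q(S △ P) ≤ 3ρ/(1−ρ) + 2·( e^C·(Err(S) − Err(S_OPT)) / ρ )^{1/C}. -/
open MeasureTheory Set
open scoped ProbabilityTheory ENNReal symmDiff

noncomputable section

/-- The noise rate `γ(x) = ρ·u(x)/(ρ·u(x) + (1−ρ)·p(x))` for `x ∈ P`, and `0` otherwise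
(note that in `ℝ≥0∞` the quotient `0/0` is `0`, so the convention for a vanishing
denominator is automatic since `ρ > 0` forces the numerator to vanish as well). -/
noncomputable def noiseRate {d : ℕ} (P : Set (EuclideanSpace ℝ (Fin d))) (ρ : ℝ)
    (p u : EuclideanSpace ℝ (Fin d) → ℝ≥0∞) (x : EuclideanSpace ℝ (Fin d)) : ℝ≥0∞ :=
  P.indicator
    (fun x => (ENNReal.ofReal ρ * u x) /
      (ENNReal.ofReal ρ * u x + ENNReal.ofReal (1 - ρ) * p x)) x

/-- The high-noise region `B_z = {x ∈ P : γ(x) ≥ z}`. -/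
noncomputable def highNoise {d : ℕ} (P : Set (EuclideanSpace ℝ (Fin d))) (ρ : ℝ)
    (p u : EuclideanSpace ℝ (Fin d) → ℝ≥0∞) (z : ℝ) : Set (EuclideanSpace ℝ (Fin d)) :=
  {x ∈ P | ENNReal.ofReal z ≤ noiseRate P ρ p u x}

/-- The classification error `Err(S) = ρ·U(S) + (1−ρ)·𝒫(ℝ^d ∖ S)`. -/
noncomputable def classErr {d : ℕ} (U Pm : Measure (EuclideanSpace ℝ (Fin d))) (ρ : ℝ)
    (S : Set (EuclideanSpace ℝ (Fin d))) : ℝ :=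
  ρ * (U S).toReal + (1 - ρ) * (Pm Sᶜ).toReal

/-- A ratio `a / (a + b)` of at least one half forces `b ≤ a`. -/
theorem ENNReal.le_of_half_le_div_add {a b : ℝ≥0∞} (h : 2⁻¹ ≤ a / (a + b)) : b ≤ a := by
  rcases eq_or_ne a ⊤ with rfl | ha
  · exact le_top
  have h₁ : 2 * (2⁻¹ * (a + b)) ≤ 2 * a := by gcongr; exact ENNReal.mul_le_of_le_div h
  rw [← mul_assoc, ENNReal.mul_inv_cancel (by simp) (by simp), one_mul, two_mul] at h₁
  exact (ENNReal.add_le_add_iff_left ha).1 h₁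

/-- A ratio `a / (a + b)` below one half, with `a` finite, forces `a ≤ b`. -/
theorem ENNReal.le_of_div_add_lt_half {a b : ℝ≥0∞} (ha : a ≠ ⊤) (h : a / (a + b) < 2⁻¹) :
    a ≤ b := by
  by_contra! hba
  refine absurd h (not_lt.2 ?_)
  have ha₀ : a ≠ 0 := (zero_le.trans_lt hba).ne'
  rw [ENNReal.le_div_iff_mul_le (.inl (by simp [ha₀])) (.inl (by simp [ha, hba.ne_top]))]
  calc 2⁻¹ * (a + b) ≤ 2⁻¹ * (a + a) := by gcongr
    _ = a := by
      rw [← two_mul, ← mul_assoc, ENNReal.inv_mul_cancel (by simp) (by simp), one_mul]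

section HighNoise

variable {d : ℕ} {P : Set (EuclideanSpace ℝ (Fin d))} {ρ : ℝ}
  {p u : EuclideanSpace ℝ (Fin d) → ℝ≥0∞} {x : EuclideanSpace ℝ (Fin d)}

theorem measurableSet_highNoise (hP : MeasurableSet P) (hp : Measurable p) (hu : Measurable u)
    (z : ℝ) : MeasurableSet (highNoise P ρ p u z) := by
  have hγ : Measurable (noiseRate P ρ p u) :=
    Measurable.indicator (by fun_prop) hP
  exact hP.inter (measurableSet_le measurable_const hγ)

theorem density_le_of_mem_highNoise_half (hx : x ∈ highNoise P ρ p u (1 / 2)) :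
    ENNReal.ofReal (1 - ρ) * p x ≤ ENNReal.ofReal ρ * u x := by
  obtain ⟨hxP, hγ⟩ := hx
  apply ENNReal.le_of_half_le_div_add
  simpa [noiseRate, hxP, ENNReal.ofReal_inv_of_pos] using hγ

theorem density_le_of_mem_diff_highNoise_half (hx : x ∈ P \ highNoise P ρ p u (1 / 2))
    (hux : u x ≠ ⊤) : ENNReal.ofReal ρ * u x ≤ ENNReal.ofReal (1 - ρ) * p x := by
  obtain ⟨hxP, hγ⟩ := hx
  apply ENNReal.le_of_div_add_lt_half (ENNReal.mul_ne_top ENNReal.ofReal_ne_top hux)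
  simpa [highNoise, noiseRate, hxP, ENNReal.ofReal_inv_of_pos] using hγ

end HighNoise

/-- An almost everywhere inequality between scaled densities on `T` gives the inequality between
the scaled measures of `T`. -/
theorem mul_toReal_withDensity_le {α : Type*} [MeasurableSpace α] {ν : Measure α}
    {f g : α → ℝ≥0∞} (hf : Measurable f) (hg : Measurable g)
    [IsFiniteMeasure (ν.withDensity g)] {a b : ℝ} (ha : 0 ≤ a) (hb : 0 ≤ b)
    {T : Set α} (hT : MeasurableSet T)
    (h : ∀ᵐ x ∂ν, x ∈ T → ENNReal.ofReal a * f x ≤ ENNReal.ofReal b * g x) :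
    a * (ν.withDensity f T).toReal ≤ b * (ν.withDensity g T).toReal := by
  have key : ENNReal.ofReal a * ν.withDensity f T ≤ ENNReal.ofReal b * ν.withDensity g T := by
    rw [withDensity_apply _ hT, withDensity_apply _ hT, ← lintegral_const_mul _ hf,
      ← lintegral_const_mul _ hg]
    exact setLIntegral_mono_ae (by fun_prop) h
  have := ENNReal.toReal_mono
    (ENNReal.mul_ne_top ENNReal.ofReal_ne_top (measure_ne_top _ T)) key
  simpa [ENNReal.toReal_mul, ha, hb] using this

/-- For `B ⊆ P`, the measure of `P \ S` splits along `B`. -/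
theorem measureReal_sdiff_add_sdiff_sdiff {α : Type*} [MeasurableSpace α] (μ : Measure α)
    [IsFiniteMeasure μ] {P B : Set α} (hB : MeasurableSet B) (hBP : B ⊆ P) (S : Set α) :
    μ.real (B \ S) + μ.real ((P \ B) \ S) = μ.real (P \ S) := by
  rw [← measureReal_inter_add_sdiff (s := P \ S) hB, inter_comm (P \ S) B,
    ← inter_sdiff_assoc, inter_eq_self_of_subset_left hBP, sdiff_sdiff_comm]

/-- The excess error of `S` over `O ⊆ P`, written on the pieces of `S ∆ O`. -/
theorem classErr_sub_classErr_diff {d : ℕ} (U Pm : Measure (EuclideanSpace ℝ (Fin d)))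
    [IsFiniteMeasure U] [IsFiniteMeasure Pm] {P B S : Set (EuclideanSpace ℝ (Fin d))} (ρ : ℝ)
    (hP : MeasurableSet P) (hB : MeasurableSet B) (hS : MeasurableSet S) (hBP : B ⊆ P)
    (hPm : Pm Pᶜ = 0) :
    classErr U Pm ρ S - classErr U Pm ρ (P \ B) =
      ρ * (U (S \ P)).toReal + (ρ * (U (B ∩ S)).toReal - (1 - ρ) * (Pm (B ∩ S)).toReal)
        + ((1 - ρ) * (Pm ((P \ B) \ S)).toReal - ρ * (U ((P \ B) \ S)).toReal) := by
  change _ = ρ * U.real (S \ P) + (ρ * U.real (B ∩ S) - (1 - ρ) * Pm.real (B ∩ S))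
        + ((1 - ρ) * Pm.real ((P \ B) \ S) - ρ * U.real ((P \ B) \ S))
  change (ρ * U.real S + (1 - ρ) * Pm.real Sᶜ)
    - (ρ * U.real (P \ B) + (1 - ρ) * Pm.real (P \ B)ᶜ) = _
  have inter_P (T : Set (EuclideanSpace ℝ (Fin d))) : Pm.real T = Pm.real (T ∩ P) :=
    measureReal_congr (inter_ae_eq_left_of_ae_eq_univ (ae_eq_univ.2 hPm)).symm
  have hS_compl : Sᶜ ∩ P = P \ S := by rw [inter_comm, sdiff_eq]
  have hO_compl : (P \ B)ᶜ ∩ P = B := by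
    rw [inter_comm, ← sdiff_eq, sdiff_sdiff_cancel_left hBP]
  have hSP_B : S ∩ P ∩ B = B ∩ S := by
    rw [inter_assoc, inter_eq_self_of_subset_right hBP, inter_comm]
  have hSP_sdiff_B : (S ∩ P) \ B = (P \ B) ∩ S := by rw [inter_sdiff_assoc, inter_comm]
  have hUS := measureReal_inter_add_sdiff (μ := U) (s := S) hP
  have hUSP := measureReal_inter_add_sdiff (μ := U) (s := S ∩ P) hB
  have hUO := measureReal_inter_add_sdiff (μ := U) (s := P \ B) hS
  have hPB := measureReal_inter_add_sdiff (μ := Pm) (s := B) hS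
  rw [hSP_B, hSP_sdiff_B] at hUSP
  rw [inter_P Sᶜ, inter_P (P \ B)ᶜ, hS_compl, hO_compl, ← hUS, ← hUSP, ← hUO,
    ← measureReal_sdiff_add_sdiff_sdiff Pm hB hBP S, ← hPB]
  ring

theorem stmt0 {d : ℕ}
    (Q U ν : Measure (EuclideanSpace ℝ (Fin d)))
    [IsProbabilityMeasure Q] [IsProbabilityMeasure U] [SigmaFinite ν]
    (P : Set (EuclideanSpace ℝ (Fin d))) (hP : MeasurableSet P) (hQP : 0 < Q P)
    (p u : EuclideanSpace ℝ (Fin d) → ℝ≥0∞) (hp : Measurable p) (hu : Measurable u)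
    (hPdens : Q[|P] = ν.withDensity p)
    (hUdens : U = ν.withDensity u)
    (hpP : ∀ᵐ x ∂ν, x ∉ P → p x = 0)
    (ρ : ℝ) (hρ : ρ ∈ Set.Ioo (0 : ℝ) 1)
    (C : ℝ) (hC : 1 ≤ C) (hρC : ρ < 1 / (3 * C))
    (hUQ : ∀ T : Set (EuclideanSpace ℝ (Fin d)), MeasurableSet T →
      Real.exp (-C) * (Q T).toReal ^ C ≤ (U T).toReal)
    (S : Set (EuclideanSpace ℝ (Fin d))) (hS : MeasurableSet S) :
    (Q (S ∆ P)).toReal ≤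
      3 * ρ / (1 - ρ) +
        2 * (Real.exp C *
              (classErr U Q[|P] ρ S - classErr U Q[|P] ρ (P \ highNoise P ρ p u (1 / 2))) / ρ)
            ^ (1 / C) := by
  obtain ⟨hρ₀, hρ₁⟩ := hρ
  have hρ₂ : 0 < 1 - ρ := by linarith
  have hC₀ : 0 < C := by linarith
  have : IsProbabilityMeasure Q[|P] := ProbabilityTheory.cond_isProbabilityMeasure hQP.ne'
  have : IsFiniteMeasure (ν.withDensity p) := hPdens ▸ inferInstance
  have : IsFiniteMeasure (ν.withDensity u) := hUdens ▸ inferInstance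
  have hcondP : Q[|P] Pᶜ = 0 := by simp [ProbabilityTheory.cond_apply hP]
  have hu_top : ∀ᵐ x ∂ν, u x ≠ ⊤ := by
    refine (ae_lt_top hu ?_).mono fun x hx => hx.ne
    simpa using measure_ne_top (ν.withDensity u) univ
  set B := highNoise P ρ p u (1 / 2)
  have hB : MeasurableSet B := measurableSet_highNoise hP hp hu _
  have hBP : B ⊆ P := fun x hx => hx.1
  have cond_le_U {T : Set (EuclideanSpace ℝ (Fin d))} (hT : MeasurableSet T) (hTB : T ⊆ B) :
      (1 - ρ) * (Q[|P] T).toReal ≤ ρ * (U T).toReal := by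
    rw [hPdens, hUdens]
    exact mul_toReal_withDensity_le hp hu hρ₂.le hρ₀.le hT
      (.of_forall fun x hx => density_le_of_mem_highNoise_half (hTB hx))
  have U_le_cond {T : Set (EuclideanSpace ℝ (Fin d))} (hT : MeasurableSet T) (hTO : T ⊆ P \ B) :
      ρ * (U T).toReal ≤ (1 - ρ) * (Q[|P] T).toReal := by
    rw [hPdens, hUdens]
    exact mul_toReal_withDensity_le hu hp hρ₀.le hρ₂.le hT
      (hu_top.mono fun x hx hxT => density_le_of_mem_diff_highNoise_half (hTO hxT) hx)
  have hε := classErr_sub_classErr_diff U Q[|P] ρ hP hB hS hBP hcondP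
  set ε := classErr U Q[|P] ρ S - classErr U Q[|P] ρ (P \ B)
  have hBS := cond_le_U (hB.inter hS) inter_subset_left
  have hBdS := cond_le_U (hB.diff hS) sdiff_subset
  have hOdS := U_le_cond ((hP.diff hB).diff hS) sdiff_subset
  have hU_le : ρ * (U (S \ P)).toReal ≤ ε := by linarith
  have hε₀ : 0 ≤ ε := le_trans (by positivity) hU_le
  have root_mono {t : ℝ} (ht₀ : 0 ≤ t) (ht : Real.exp (-C) * t ^ C ≤ ε / ρ) :
      t ≤ (Real.exp C * ε / ρ) ^ (1 / C) := by
    rw [one_div, Real.le_rpow_inv_iff_of_pos ht₀ (by positivity) hC₀]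
    rw [Real.exp_neg, inv_mul_le_iff₀ (Real.exp_pos C)] at ht
    rwa [mul_div_assoc]
  have hQ_SP : (Q (S \ P)).toReal ≤ (Real.exp C * ε / ρ) ^ (1 / C) := by
    refine root_mono ENNReal.toReal_nonneg ((hUQ _ (hS.diff hP)).trans ?_)
    rwa [le_div_iff₀' hρ₀]
  have hr₀ : 0 ≤ (Real.exp C * ε / ρ) ^ (1 / C) := ENNReal.toReal_nonneg.trans hQ_SP
  have hq : 0 ≤ 3 * ρ / (1 - ρ) := by positivity
  rcases le_total ρ ε with hρε | hερ
  · have h₁ : 1 ≤ (Real.exp C * ε / ρ) ^ (1 / C) := by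
      refine root_mono zero_le_one ?_
      calc Real.exp (-C) * 1 ^ C ≤ 1 := by simp [hC₀.le]
        _ ≤ ε / ρ := (one_le_div hρ₀).2 hρε
    have hQ₁ : (Q (S ∆ P)).toReal ≤ 1 := measureReal_le_one
    linarith
  · have hcond : (1 - ρ) * (Q[|P] (P \ S)).toReal ≤ 2 * ρ := by
      have hc : (Q[|P] (B \ S)).toReal + (Q[|P] ((P \ B) \ S)).toReal =
          (Q[|P] (P \ S)).toReal := measureReal_sdiff_add_sdiff_sdiff _ hB hBP S
      have hU : (U (B \ S)).toReal + (U ((P \ B) \ S)).toReal = (U (P \ S)).toReal :=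
        measureReal_sdiff_add_sdiff_sdiff _ hB hBP S
      have hU₁ : ρ * (U (P \ S)).toReal ≤ ρ * 1 := by gcongr; exact measureReal_le_one
      rw [← hU, mul_add] at hU₁
      rw [← hc, mul_add]
      have : 0 ≤ ρ * (U (S \ P)).toReal := by positivity
      linarith
    have hQ_cond : (Q (P \ S)).toReal ≤ (Q[|P] (P \ S)).toReal := by
      refine ENNReal.toReal_mono (measure_ne_top _ _) ?_
      rw [ProbabilityTheory.cond_apply hP, inter_eq_self_of_subset_right sdiff_subset]
      exact le_mul_of_one_le_left' (ENNReal.one_le_inv.2 prob_le_one)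
    have hQ_PS : (Q (P \ S)).toReal ≤ 3 * ρ / (1 - ρ) := by
      rw [le_div_iff₀' hρ₂]
      have := mul_le_mul_of_nonneg_left hQ_cond hρ₂.le
      linarith
    have hunion : (Q (S ∆ P)).toReal ≤ (Q (S \ P)).toReal + (Q (P \ S)).toReal :=
      measureReal_union_le (μ := Q) _ _
    linarith
end
end

section
/- Fix r, R > 0 and set C := max{Λ·R·(R+r), 1 + R/r}. In the exponential-family setup, if θ₁, θ₂ ∈ Θ are such that the closed Euclidean balls of radius r centered at θ₁ and at θ₂ are contained in Θ and ‖θ₁ − θ₂‖₂ ≤ R, then for every Borel set T ⊆ ℝ^d: e^{−C}·μ_{θ₂}(T)^C ≤ μ_{θ₁}(T) ≤ e^{C}·μ_{θ₂}(T)^{1/C}. -/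
open MeasureTheory Real
open scoped RealInnerProductSpace ENNReal

noncomputable section

/-- The partition function `Z(θ) = ∫ h(x)·exp(⟨θ, t(x)⟩) dx` of an exponential family. -/
noncomputable def partitionFn {d m : ℕ} (h : EuclideanSpace ℝ (Fin d) → ℝ)
    (t : EuclideanSpace ℝ (Fin d) → EuclideanSpace ℝ (Fin m))
    (θ : EuclideanSpace ℝ (Fin m)) : ℝ :=
  ∫ x, h x * Real.exp ⟪θ, t x⟫

/-- The log-partition function `A(θ) = log Z(θ)`. -/
noncomputable def logPartitionFn {d m : ℕ} (h : EuclideanSpace ℝ (Fin d) → ℝ)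
    (t : EuclideanSpace ℝ (Fin d) → EuclideanSpace ℝ (Fin m))
    (θ : EuclideanSpace ℝ (Fin m)) : ℝ :=
  Real.log (partitionFn h t θ)

/-- The exponential-family measure `μ_θ`, with Lebesgue density
`x ↦ h(x)·exp(⟨θ, t(x)⟩)/Z(θ)`. -/
noncomputable def expFamMeasure {d m : ℕ} (h : EuclideanSpace ℝ (Fin d) → ℝ)
    (t : EuclideanSpace ℝ (Fin d) → EuclideanSpace ℝ (Fin m))
    (θ : EuclideanSpace ℝ (Fin m)) : Measure (EuclideanSpace ℝ (Fin d)) :=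
  volume.withDensity fun x => ENNReal.ofReal (h x * Real.exp ⟪θ, t x⟫ / partitionFn h t θ)

section LogConvexity

variable {d m : ℕ} {h : EuclideanSpace ℝ (Fin d) → ℝ}
  {t : EuclideanSpace ℝ (Fin d) → EuclideanSpace ℝ (Fin m)}

/-- The normalized densities are log-convex in the parameter, up to the Jensen gap of `A`. -/
lemma expFam_density_eq (hh0 : ∀ x, 0 ≤ h x) {θ θ' η : EuclideanSpace ℝ (Fin m)} {a b : ℝ}
    (ha : 0 < a) (hab : a + b = 1) (hη : η = a • θ + b • θ')
    (hZ : 0 < partitionFn h t θ) (hZ' : 0 < partitionFn h t θ') (hZη : 0 < partitionFn h t η)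
    (x : EuclideanSpace ℝ (Fin d)) :
    h x * Real.exp ⟪η, t x⟫ / partitionFn h t η =
      Real.exp (a * logPartitionFn h t θ + b * logPartitionFn h t θ' - logPartitionFn h t η) *
        ((h x * Real.exp ⟪θ, t x⟫ / partitionFn h t θ) ^ a *
          (h x * Real.exp ⟪θ', t x⟫ / partitionFn h t θ') ^ b) := by
  rcases (hh0 x).eq_or_lt with h0 | h0
  · simp [← h0, Real.zero_rpow ha.ne']
  have key : ∀ ξ, 0 < partitionFn h t ξ → h x * Real.exp ⟪ξ, t x⟫ / partitionFn h t ξ =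
      Real.exp (Real.log (h x) + ⟪ξ, t x⟫ - logPartitionFn h t ξ) := fun ξ hξ => by
    rw [Real.exp_sub, Real.exp_add, Real.exp_log h0, logPartitionFn, Real.exp_log hξ]
  rw [key θ hZ, key θ' hZ', key η hZη, ← Real.exp_mul, ← Real.exp_mul, ← Real.exp_add,
    ← Real.exp_add, hη, inner_add_left, real_inner_smul_left, real_inner_smul_left]
  congr 1
  linear_combination (-Real.log (h x)) * hab

lemma expFamMeasure_univ (hh0 : ∀ x, 0 ≤ h x) {θ : EuclideanSpace ℝ (Fin m)}
    (hint : Integrable fun x => h x * Real.exp ⟪θ, t x⟫) (hZ : 0 < partitionFn h t θ) :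
    expFamMeasure h t θ Set.univ = 1 := by
  rw [expFamMeasure, withDensity_apply _ MeasurableSet.univ, Measure.restrict_univ,
    ← ofReal_integral_eq_lintegral_ofReal (hint.div_const _)
      (.of_forall fun x => div_nonneg (mul_nonneg (hh0 x) (Real.exp_pos _).le) hZ.le),
    integral_div]
  change ENNReal.ofReal (partitionFn h t θ / partitionFn h t θ) = 1
  rw [div_self hZ.ne', ENNReal.ofReal_one]

/-- Hölder's inequality for the measures of an exponential family. -/
lemma expFamMeasure_toReal_le (hh : Measurable h) (ht : Measurable t) (hh0 : ∀ x, 0 ≤ h x)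
    {θ θ' η : EuclideanSpace ℝ (Fin m)} {a b : ℝ}
    (ha : 0 < a) (hb : 0 ≤ b) (hab : a + b = 1) (hη : η = a • θ + b • θ')
    (hint : Integrable fun x => h x * Real.exp ⟪θ, t x⟫)
    (hint' : Integrable fun x => h x * Real.exp ⟪θ', t x⟫)
    (hZ : 0 < partitionFn h t θ) (hZ' : 0 < partitionFn h t θ') (hZη : 0 < partitionFn h t η)
    {T : Set (EuclideanSpace ℝ (Fin d))} (hT : MeasurableSet T) :
    (expFamMeasure h t η T).toReal ≤
      Real.exp (a * logPartitionFn h t θ + b * logPartitionFn h t θ' - logPartitionFn h t η) *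
        (expFamMeasure h t θ T).toReal ^ a := by
  set K := Real.exp
    (a * logPartitionFn h t θ + b * logPartitionFn h t θ' - logPartitionFn h t η)
  have hK : 0 ≤ K := (Real.exp_pos _).le
  have hmeas : ∀ ξ : EuclideanSpace ℝ (Fin m), Measurable fun x =>
      ENNReal.ofReal (h x * Real.exp ⟪ξ, t x⟫ / partitionFn h t ξ) := fun ξ => by fun_prop
  have hnonneg : ∀ ξ, 0 < partitionFn h t ξ → ∀ x,
      0 ≤ h x * Real.exp ⟪ξ, t x⟫ / partitionFn h t ξ := fun ξ hξ x =>
    div_nonneg (mul_nonneg (hh0 x) (Real.exp_pos _).le) hξ.le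
  have le_one : ∀ ξ, Integrable (fun x => h x * Real.exp ⟪ξ, t x⟫) → 0 < partitionFn h t ξ →
      expFamMeasure h t ξ T ≤ 1 := fun ξ h₁ h₂ =>
    (measure_mono (Set.subset_univ T)).trans (expFamMeasure_univ hh0 h₁ h₂).le
  have main : expFamMeasure h t η T ≤ ENNReal.ofReal K * expFamMeasure h t θ T ^ a := by
    calc expFamMeasure h t η T
        = ∫⁻ x in T, ENNReal.ofReal K *
            (ENNReal.ofReal (h x * Real.exp ⟪θ, t x⟫ / partitionFn h t θ) ^ a *
              ENNReal.ofReal (h x * Real.exp ⟪θ', t x⟫ / partitionFn h t θ') ^ b) := by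
          rw [expFamMeasure, withDensity_apply _ hT]
          refine lintegral_congr fun x => ?_
          rw [expFam_density_eq hh0 ha hab hη hZ hZ' hZη x, ENNReal.ofReal_mul hK,
            ENNReal.ofReal_mul (Real.rpow_nonneg (hnonneg θ hZ x) a),
            ENNReal.ofReal_rpow_of_nonneg (hnonneg θ hZ x) ha.le,
            ENNReal.ofReal_rpow_of_nonneg (hnonneg θ' hZ' x) hb]
      _ = ENNReal.ofReal K * ∫⁻ x in T,
            ENNReal.ofReal (h x * Real.exp ⟪θ, t x⟫ / partitionFn h t θ) ^ a *
              ENNReal.ofReal (h x * Real.exp ⟪θ', t x⟫ / partitionFn h t θ') ^ b :=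
          lintegral_const_mul' _ _ ENNReal.ofReal_ne_top
      _ ≤ ENNReal.ofReal K * (expFamMeasure h t θ T ^ a * expFamMeasure h t θ' T ^ b) := by
          gcongr
          simp only [expFamMeasure, withDensity_apply _ hT]
          exact ENNReal.lintegral_mul_norm_pow_le (hmeas θ).aemeasurable (hmeas θ').aemeasurable
            ha.le hb hab
      _ ≤ ENNReal.ofReal K * (expFamMeasure h t θ T ^ a * 1) := by
          gcongr
          exact ENNReal.rpow_le_one (le_one θ' hint' hZ') hb
      _ = ENNReal.ofReal K * expFamMeasure h t θ T ^ a := by rw [mul_one]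
  have htop : ENNReal.ofReal K * expFamMeasure h t θ T ^ a ≠ ⊤ :=
    ENNReal.mul_ne_top ENNReal.ofReal_ne_top
      (ENNReal.rpow_ne_top_of_nonneg ha.le ((le_one θ hint hZ).trans_lt ENNReal.one_lt_top).ne)
  calc (expFamMeasure h t η T).toReal
      ≤ (ENNReal.ofReal K * expFamMeasure h t θ T ^ a).toReal := ENNReal.toReal_mono htop main
    _ = K * (expFamMeasure h t θ T).toReal ^ a := by
        rw [ENNReal.toReal_mul, ENNReal.toReal_ofReal hK, ENNReal.toReal_rpow]

/-- Comparison of two members of a smooth exponential family, obtained by extrapolating from `θ`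
past `η` by the distance `r`. -/
lemma expFamMeasure_toReal_le_of_smooth
    (hh : Measurable h) (ht : Measurable t) (hh0 : ∀ x, 0 ≤ h x)
    {Θ : Set (EuclideanSpace ℝ (Fin m))} {Λ : ℝ} (hΛ : 0 ≤ Λ)
    (hint : ∀ θ ∈ Θ, Integrable (fun x => h x * Real.exp ⟪θ, t x⟫))
    (hZpos : ∀ θ ∈ Θ, 0 < partitionFn h t θ)
    {r : ℝ} (hr : 0 < r) {η θ g : EuclideanSpace ℝ (Fin m)}
    (hsmooth : ∀ θ' ∈ Θ, logPartitionFn h t θ' ≤ logPartitionFn h t η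
        + ⟪g, θ' - η⟫ + Λ / 2 * ‖θ' - η‖ ^ 2)
    (hη : Metric.closedBall η r ⊆ Θ) (hθ : θ ∈ Θ)
    {T : Set (EuclideanSpace ℝ (Fin d))} (hT : MeasurableSet T) :
    (expFamMeasure h t η T).toReal ≤ Real.exp (Λ * r * ‖η - θ‖ / 2) *
      (expFamMeasure h t θ T).toReal ^ (r / (‖η - θ‖ + r)) := by
  set D := ‖η - θ‖ with hD
  have hD0 : 0 ≤ D := norm_nonneg _
  have hDr : 0 < D + r := by positivity
  set u := D⁻¹ • (η - θ) with hu
  have hDu : D • u = η - θ := by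
    rcases eq_or_ne D 0 with h0 | h0
    · rw [h0, zero_smul, norm_eq_zero.mp (hD.symm.trans h0)]
    · rw [hu, smul_inv_smul₀ h0]
  have hu1 : ‖u‖ ≤ 1 := by
    rw [hu, norm_smul, norm_inv, Real.norm_of_nonneg hD0]
    exact inv_mul_le_one
  have hru : ‖r • u‖ ≤ r := by
    rw [norm_smul, Real.norm_of_nonneg hr.le]
    exact mul_le_of_le_one_right hr.le hu1
  have hθ' : η + r • u ∈ Θ := hη (by simpa [dist_eq_norm] using hru)
  have hηΘ : η ∈ Θ := hη (Metric.mem_closedBall_self hr.le)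
  have hab : r / (D + r) + D / (D + r) = 1 := by field_simp; ring
  have hrD : r / (D + r) * D = D / (D + r) * r := by ring
  have hcomb : η = (r / (D + r)) • θ + (D / (D + r)) • (η + r • u) := by
    have hθeq : θ = η - D • u := by rw [hDu, sub_sub_cancel]
    calc η = (r / (D + r) + D / (D + r)) • η := by rw [hab, one_smul]
      _ = (r / (D + r)) • (η - D • u) + (D / (D + r)) • (η + r • u) := by
        rw [smul_sub, smul_add, smul_smul _ D u, smul_smul _ r u, hrD, add_smul]
        abel
      _ = (r / (D + r)) • θ + (D / (D + r)) • (η + r • u) := by rw [← hθeq]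
  refine (expFamMeasure_toReal_le hh ht hh0 (by positivity) (by positivity) hab hcomb
    (hint _ hθ) (hint _ hθ') (hZpos _ hθ) (hZpos _ hθ') (hZpos _ hηΘ) hT).trans ?_
  gcongr
  have h₁ := hsmooth _ hθ
  have h₂ := hsmooth _ hθ'
  rw [show θ - η = -(D • u) by rw [hDu, neg_sub], norm_neg, hDu, ← hD, ← hDu, inner_neg_right,
    real_inner_smul_right] at h₁
  rw [add_sub_cancel_left, real_inner_smul_right] at h₂
  have h₃ : Λ / 2 * ‖r • u‖ ^ 2 ≤ Λ / 2 * r ^ 2 := by gcongr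
  have ha : 0 ≤ r / (D + r) := by positivity
  have hb : 0 ≤ D / (D + r) := by positivity
  have h₄ := mul_le_mul_of_nonneg_left h₁ ha
  have h₅ := mul_le_mul_of_nonneg_left (h₂.trans (add_le_add_right h₃ _)) hb
  have h₆ : r / (D + r) * (logPartitionFn h t η + -(D * ⟪g, u⟫) + Λ / 2 * D ^ 2) +
      D / (D + r) * (logPartitionFn h t η + r * ⟪g, u⟫ + Λ / 2 * r ^ 2) =
      logPartitionFn h t η + Λ * r * D / 2 := by field_simp; ring
  linarith

end LogConvexity

theorem stmt5 {d m : ℕ}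
    (h : EuclideanSpace ℝ (Fin d) → ℝ)
    (t : EuclideanSpace ℝ (Fin d) → EuclideanSpace ℝ (Fin m))
    (hh : Measurable h) (ht : Measurable t) (hh0 : ∀ x, 0 ≤ h x)
    (Θ : Set (EuclideanSpace ℝ (Fin m))) (Λ : ℝ) (hΛ : 0 < Λ)
    (hint : ∀ θ ∈ Θ, Integrable (fun x => h x * Real.exp ⟪θ, t x⟫))
    (hZpos : ∀ θ ∈ Θ, 0 < partitionFn h t θ)
    (hdiff : ∀ θ ∈ Θ, DifferentiableAt ℝ (logPartitionFn h t) θ)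
    (hsmooth : ∀ θ ∈ Θ, ∀ θ' ∈ Θ,
      logPartitionFn h t θ' ≤ logPartitionFn h t θ
        + ⟪gradient (logPartitionFn h t) θ, θ' - θ⟫ + Λ / 2 * ‖θ' - θ‖ ^ 2)
    (r R : ℝ) (hr : 0 < r) (hR : 0 < R)
    (C : ℝ) (hC : C = max (Λ * R * (R + r)) (1 + R / r))
    (θ₁ θ₂ : EuclideanSpace ℝ (Fin m))
    (hθ₁ : Metric.closedBall θ₁ r ⊆ Θ) (hθ₂ : Metric.closedBall θ₂ r ⊆ Θ)
    (hdist : ‖θ₁ - θ₂‖ ≤ R)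
    (T : Set (EuclideanSpace ℝ (Fin d))) (hT : MeasurableSet T) :
    Real.exp (-C) * (expFamMeasure h t θ₂ T).toReal ^ C ≤ (expFamMeasure h t θ₁ T).toReal ∧
      (expFamMeasure h t θ₁ T).toReal ≤
        Real.exp C * (expFamMeasure h t θ₂ T).toReal ^ (1 / C) := by
  have mem₁ : θ₁ ∈ Θ := hθ₁ (Metric.mem_closedBall_self hr.le)
  have mem₂ : θ₂ ∈ Θ := hθ₂ (Metric.mem_closedBall_self hr.le)
  have h₁ := expFamMeasure_toReal_le_of_smooth hh ht hh0 hΛ.le hint hZpos hr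
    (hsmooth θ₁ mem₁) hθ₁ mem₂ hT
  have h₂ := expFamMeasure_toReal_le_of_smooth hh ht hh0 hΛ.le hint hZpos hr
    (hsmooth θ₂ mem₂) hθ₂ mem₁ hT
  rw [norm_sub_rev θ₂ θ₁] at h₂
  have q_le_one : (expFamMeasure h t θ₂ T).toReal ≤ 1 :=
    ENNReal.toReal_le_of_le_ofReal zero_le_one <| by
      rw [ENNReal.ofReal_one, ← expFamMeasure_univ hh0 (hint θ₂ mem₂) (hZpos θ₂ mem₂)]
      exact measure_mono (Set.subset_univ T)
  set p := (expFamMeasure h t θ₁ T).toReal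
  set q := (expFamMeasure h t θ₂ T).toReal
  set D := ‖θ₁ - θ₂‖
  have hp0 : 0 ≤ p := ENNReal.toReal_nonneg
  have hq0 : 0 ≤ q := ENNReal.toReal_nonneg
  have hD0 : 0 ≤ D := norm_nonneg _
  have hC₁ : Λ * R * (R + r) ≤ C := hC ▸ le_max_left _ _
  have hC₂ : 1 + R / r ≤ C := hC ▸ le_max_right _ _
  have hexp : (D + r) / r ≤ C := by
    refine le_trans ?_ hC₂
    rw [add_div, div_self hr.ne', add_comm]
    gcongr
  have hC0 : 0 < C := lt_of_lt_of_le (by positivity) hC₂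
  have hgap : Λ * D * (D + r) / 2 ≤ C := by
    have : Λ * D * (D + r) ≤ Λ * R * (R + r) := by gcongr
    linarith
  constructor
  · rcases hq0.eq_or_lt with h0 | hqpos
    · rw [← h0, Real.zero_rpow hC0.ne', mul_zero]
      exact hp0
    have hpow := Real.rpow_le_rpow hq0 h₂ (by positivity : 0 ≤ (D + r) / r)
    rw [Real.mul_rpow (Real.exp_pos _).le (by positivity), ← Real.rpow_mul hp0, ← Real.exp_mul,
      show r / (D + r) * ((D + r) / r) = 1 by field_simp, Real.rpow_one,
      show Λ * r * D / 2 * ((D + r) / r) = Λ * D * (D + r) / 2 by field_simp] at hpow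
    calc Real.exp (-C) * q ^ C
        ≤ Real.exp (-C) * q ^ ((D + r) / r) := by
          gcongr ?_ * ?_
          exact Real.rpow_le_rpow_of_exponent_ge hqpos q_le_one hexp
      _ ≤ Real.exp (-C) * (Real.exp C * p) := by
          gcongr
          exact hpow.trans (by gcongr)
      _ = p := by rw [← mul_assoc, ← Real.exp_add, neg_add_cancel, Real.exp_zero, one_mul]
  · refine h₁.trans (mul_le_mul (Real.exp_le_exp.mpr ?_) ?_ (by positivity) (by positivity))
    · have : Λ * D * r ≤ Λ * D * (D + r) := by gcongr; linarith
      linarith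
    · refine Real.rpow_le_rpow_of_exponent_ge_of_imp hq0 q_le_one ?_ ?_
      · rw [div_le_iff₀ hC0]
        rw [div_le_iff₀ hr] at hexp
        rw [div_mul_eq_mul_div, le_div_iff₀ (by positivity)]
        linarith
      · intro _ h0
        exact absurd h0 (by positivity)
end
end

section
/- Let τ ∈ ℝ, let γ_τ be the standard normal distribution truncated to [τ,∞), and let m := ∫ x dγ_τ(x) be its mean. Then the third central moment satisfies ∫ (x − m)³ dγ_τ(x) ≥ 10^{−10} · e^{−τ²/2} / max(1, τ^{12}). -/
open MeasureTheory Real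
open scoped ProbabilityTheory

noncomputable section

/-- The standard normal distribution truncated to `[τ, ∞)`:
`γ_τ(A) = ℙ_{Z ∼ N(0,1)}(Z ∈ A ∩ [τ,∞)) / ℙ_{Z ∼ N(0,1)}(Z ≥ τ)`. -/
noncomputable def truncGaussian (τ : ℝ) : Measure ℝ :=
  (ProbabilityTheory.gaussianReal 0 1)[|Set.Ici τ]

open Filter Topology Set

/-- The unnormalised standard Gaussian density. -/
def gaussKernel (x : ℝ) : ℝ := Real.exp (-x ^ 2 / 2)

/-- The unnormalised standard Gaussian tail. -/
def gaussTail (τ : ℝ) : ℝ := ∫ x in Ioi τ, gaussKernel x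

lemma gaussKernel_pos (x : ℝ) : 0 < gaussKernel x := Real.exp_pos _

lemma gaussKernel_eq (x : ℝ) : gaussKernel x = Real.exp (-(1 / 2) * x ^ 2) := by
  unfold gaussKernel; congr 1; ring

lemma continuous_gaussKernel : Continuous gaussKernel := by
  unfold gaussKernel; fun_prop

lemma hasDerivAt_gaussKernel (x : ℝ) : HasDerivAt gaussKernel (-x * gaussKernel x) x := by
  have h : HasDerivAt (fun x : ℝ => -x ^ 2 / 2) (-x) x := by
    exact ((hasDerivAt_pow 2 x).neg.div_const 2).congr_deriv (by simp; ring)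
  have h3 := h.exp
  unfold gaussKernel
  convert h3 using 1
  ring

lemma integrable_pow_mul_gaussKernel (n : ℕ) : Integrable fun x => x ^ n * gaussKernel x := by
  have h := integrable_rpow_mul_exp_neg_mul_sq (b := 1 / 2) (by norm_num) (s := n)
    (by have : (0 : ℝ) ≤ n := n.cast_nonneg
        linarith)
  simpa only [Real.rpow_natCast, ← gaussKernel_eq] using h

lemma integrable_gaussKernel : Integrable gaussKernel := by
  simpa using integrable_pow_mul_gaussKernel 0

lemma tendsto_pow_mul_gaussKernel (n : ℕ) :
    Tendsto (fun x => x ^ n * gaussKernel x) atTop (𝓝 0) := by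
  have h := (tendsto_rpow_abs_mul_exp_neg_mul_sq_cocompact (a := 1 / 2) (by norm_num) n).mono_left
    atTop_le_cocompact
  refine h.congr' ?_
  filter_upwards [eventually_ge_atTop 0] with x hx
  rw [abs_of_nonneg hx, Real.rpow_natCast, gaussKernel_eq]

lemma tendsto_gaussKernel : Tendsto gaussKernel atTop (𝓝 0) := by
  simpa using tendsto_pow_mul_gaussKernel 0

lemma gaussTail_pos (τ : ℝ) : 0 < gaussTail τ := by
  unfold gaussTail
  rw [setIntegral_pos_iff_support_of_nonneg_ae
    (Eventually.of_forall fun x => (gaussKernel_pos x).le) integrable_gaussKernel.integrableOn]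
  have : Function.support gaussKernel = univ :=
    Function.support_eq_univ fun x => (gaussKernel_pos x).ne'
  simp [this]

lemma gaussTail_le (τ : ℝ) : gaussTail τ ≤ 3 := by
  have h1 : gaussTail τ ≤ ∫ x, gaussKernel x :=
    setIntegral_le_integral integrable_gaussKernel
      (Eventually.of_forall fun x => (gaussKernel_pos x).le)
  have h2 : ∫ x, gaussKernel x = √(π / (1 / 2)) := by
    simp only [gaussKernel_eq]
    exact integral_gaussian _
  have h3 : √(π / (1 / 2)) ≤ 3 := by
    rw [Real.sqrt_le_left (by norm_num)]
    linarith [Real.pi_lt_d2]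
  linarith

lemma hasDerivAt_gaussTail (τ : ℝ) : HasDerivAt gaussTail (-gaussKernel τ) τ := by
  have h : gaussTail = fun t => gaussTail 0 - ∫ x in (0 : ℝ)..t, gaussKernel x := by
    funext t
    have := intervalIntegral.integral_interval_add_Ioi (a := 0) (b := t)
      integrable_gaussKernel.integrableOn integrable_gaussKernel.integrableOn
    unfold gaussTail
    linarith
  rw [h]
  exact (continuous_gaussKernel.integral_hasStrictDerivAt 0 τ).hasDerivAt.const_sub _

lemma integral_mul_gaussKernel (τ : ℝ) : ∫ x in Ioi τ, x * gaussKernel x = gaussKernel τ := by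
  have h := integral_Ioi_of_hasDerivAt_of_tendsto' (a := τ) (f := fun x => -gaussKernel x)
    (f' := fun x => x * gaussKernel x) (m := 0)
    (fun x _ => (hasDerivAt_gaussKernel x).neg.congr_deriv (by ring))
    (by simpa using (integrable_pow_mul_gaussKernel 1).integrableOn)
    (by simpa using tendsto_gaussKernel.neg)
  simpa using h

lemma integral_sq_mul_gaussKernel (τ : ℝ) :
    ∫ x in Ioi τ, x ^ 2 * gaussKernel x = τ * gaussKernel τ + gaussTail τ := by
  have h := integral_Ioi_of_hasDerivAt_of_tendsto' (a := τ) (f := fun x => -(x * gaussKernel x))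
    (f' := fun x => x ^ 2 * gaussKernel x - gaussKernel x) (m := 0)
    (fun x _ => ((hasDerivAt_id x).mul (hasDerivAt_gaussKernel x)).neg.congr_deriv
      (by simp; ring))
    ((integrable_pow_mul_gaussKernel 2).sub integrable_gaussKernel).integrableOn
    (by simpa using (tendsto_pow_mul_gaussKernel 1).neg)
  rw [integral_sub (integrable_pow_mul_gaussKernel 2).integrableOn
    integrable_gaussKernel.integrableOn] at h
  unfold gaussTail
  linarith

lemma integral_cube_mul_gaussKernel (τ : ℝ) :
    ∫ x in Ioi τ, x ^ 3 * gaussKernel x = (τ ^ 2 + 2) * gaussKernel τ := by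
  have h := integral_Ioi_of_hasDerivAt_of_tendsto' (a := τ)
    (f := fun x => -((x ^ 2 + 2) * gaussKernel x))
    (f' := fun x => x ^ 3 * gaussKernel x) (m := 0)
    (fun x _ => (((hasDerivAt_pow 2 x).add_const 2).mul
      (hasDerivAt_gaussKernel x)).neg.congr_deriv (by simp; ring))
    (integrable_pow_mul_gaussKernel 3).integrableOn
    (by simpa [add_mul] using
      ((tendsto_pow_mul_gaussKernel 2).add (tendsto_gaussKernel.const_mul 2)).neg)
  simpa using h

lemma mul_gaussTail_le (τ : ℝ) : τ * gaussTail τ ≤ gaussKernel τ := by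
  rw [← integral_mul_gaussKernel τ, gaussTail, ← integral_const_mul]
  refine setIntegral_mono_on (integrable_gaussKernel.const_mul τ).integrableOn
    (by simpa using (integrable_pow_mul_gaussKernel 1).integrableOn) measurableSet_Ioi ?_
  intro x hx
  exact mul_le_mul_of_nonneg_right (mem_Ioi.1 hx).le (gaussKernel_pos x).le

lemma integral_sub_sq_mul_gaussKernel (τ a : ℝ) :
    ∫ x in Ioi τ, (x - a) ^ 2 * gaussKernel x =
      τ * gaussKernel τ + gaussTail τ - 2 * a * gaussKernel τ + a ^ 2 * gaussTail τ := by
  have i1 : IntegrableOn (fun x => x * gaussKernel x) (Ioi τ) := by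
    simpa using (integrable_pow_mul_gaussKernel 1).integrableOn
  have i2 := (integrable_pow_mul_gaussKernel 2).integrableOn (s := Ioi τ)
  have i0 := integrable_gaussKernel.integrableOn (s := Ioi τ)
  have : (fun x => (x - a) ^ 2 * gaussKernel x) = fun x =>
      x ^ 2 * gaussKernel x - 2 * a * (x * gaussKernel x) + a ^ 2 * gaussKernel x := by
    funext x; ring
  have j : IntegrableOn (fun x => x ^ 2 * gaussKernel x - 2 * a * (x * gaussKernel x)) (Ioi τ) :=
    i2.sub (i1.const_mul _)
  rw [this, integral_add j (i0.const_mul _),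
    integral_sub i2 (i1.const_mul _), integral_const_mul, integral_const_mul,
    integral_mul_gaussKernel, integral_sq_mul_gaussKernel, gaussTail]

lemma integral_sub_cube_mul_gaussKernel (τ a : ℝ) :
    ∫ x in Ioi τ, (x - a) ^ 3 * gaussKernel x =
      (τ ^ 2 + 2) * gaussKernel τ - 3 * a * (τ * gaussKernel τ + gaussTail τ) +
        (3 * a ^ 2 * gaussKernel τ - a ^ 3 * gaussTail τ) := by
  have i1 : IntegrableOn (fun x => x * gaussKernel x) (Ioi τ) := by
    simpa using (integrable_pow_mul_gaussKernel 1).integrableOn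
  have i2 := (integrable_pow_mul_gaussKernel 2).integrableOn (s := Ioi τ)
  have i3 := (integrable_pow_mul_gaussKernel 3).integrableOn (s := Ioi τ)
  have i0 := integrable_gaussKernel.integrableOn (s := Ioi τ)
  have : (fun x => (x - a) ^ 3 * gaussKernel x) = fun x =>
      (x ^ 3 * gaussKernel x - 3 * a * (x ^ 2 * gaussKernel x)) +
        (3 * a ^ 2 * (x * gaussKernel x) - a ^ 3 * gaussKernel x) := by
    funext x; ring
  have j : IntegrableOn (fun x => x ^ 3 * gaussKernel x - 3 * a * (x ^ 2 * gaussKernel x))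
    (Ioi τ) := i3.sub (i2.const_mul _)
  have k : IntegrableOn (fun x => 3 * a ^ 2 * (x * gaussKernel x) - a ^ 3 * gaussKernel x)
    (Ioi τ) := (i1.const_mul _).sub (i0.const_mul _)
  rw [this, integral_add j k,
    integral_sub i3 (i2.const_mul _), integral_sub (i1.const_mul _) (i0.const_mul _),
    integral_const_mul, integral_const_mul, integral_const_mul,
    integral_mul_gaussKernel, integral_sq_mul_gaussKernel, integral_cube_mul_gaussKernel,
    gaussTail]

/-- The variance of the truncated Gaussian is nonnegative. -/
lemma truncGaussian_variance_nonneg (τ : ℝ) :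
    0 ≤ 1 + τ * (gaussKernel τ / gaussTail τ) - (gaussKernel τ / gaussTail τ) ^ 2 := by
  have hQ := gaussTail_pos τ
  have h : 0 ≤ ∫ x in Ioi τ, (x - gaussKernel τ / gaussTail τ) ^ 2 * gaussKernel x :=
    integral_nonneg fun x => mul_nonneg (sq_nonneg _) (gaussKernel_pos x).le
  rw [integral_sub_sq_mul_gaussKernel] at h
  refine nonneg_of_mul_nonneg_right (a := gaussTail τ) (h.trans_eq ?_) hQ
  field_simp
  ring

/-- The expectation of `F` under the truncated Gaussian. -/
lemma integral_truncGaussian (τ : ℝ) (F : ℝ → ℝ) :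
    ∫ x, F x ∂truncGaussian τ = (∫ x in Ioi τ, F x * gaussKernel x) / gaussTail τ := by
  obtain ⟨c, hc⟩ : ∃ c : ℝ, ∀ F : ℝ → ℝ,
      ∫ x, F x ∂truncGaussian τ = c * ∫ x in Ioi τ, F x * gaussKernel x := by
    refine ⟨((ProbabilityTheory.gaussianReal 0 1 (Ici τ))⁻¹).toReal * (√(2 * π))⁻¹, fun F => ?_⟩
    rw [truncGaussian, ProbabilityTheory.cond, integral_smul_measure,
      ProbabilityTheory.gaussianReal_of_var_ne_zero _ one_ne_zero,
      setIntegral_withDensity_eq_setIntegral_toReal_smul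
        (ProbabilityTheory.measurable_gaussianPDF 0 1)
        (Eventually.of_forall fun x => ProbabilityTheory.gaussianPDF_lt_top) _ measurableSet_Ici,
      integral_Ici_eq_integral_Ioi, smul_eq_mul, mul_assoc]
    congr 1
    rw [← integral_const_mul]
    congr 1
    funext x
    rw [ProbabilityTheory.toReal_gaussianPDF, ProbabilityTheory.gaussianPDFReal_def]
    simp [gaussKernel]
    ring
  have hne : ProbabilityTheory.gaussianReal 0 1 (Ici τ) ≠ 0 := by
    intro h0
    have := ProbabilityTheory.gaussianReal_absolutelyContinuous' 0 one_ne_zero h0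
    simp at this
  have : IsProbabilityMeasure (truncGaussian τ) :=
    ProbabilityTheory.cond_isProbabilityMeasure hne
  have h1 := hc fun _ => 1
  simp only [one_mul, integral_const, probReal_univ, smul_eq_mul, mul_one] at h1
  change 1 = c * gaussTail τ at h1
  rw [hc, eq_div_iff (gaussTail_pos τ).ne']
  linear_combination (-∫ x in Ioi τ, F x * gaussKernel x) * h1

/-- The third central moment of the truncated Gaussian in terms of its mean. -/
lemma truncGaussian_third_central_moment (τ : ℝ) :
    ∫ x, (x - ∫ y, y ∂truncGaussian τ) ^ 3 ∂truncGaussian τ =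
      gaussKernel τ / gaussTail τ * (2 * (gaussKernel τ / gaussTail τ) ^ 2 -
        3 * τ * (gaussKernel τ / gaussTail τ) + τ ^ 2 - 1) := by
  have hQ := gaussTail_pos τ
  rw [integral_truncGaussian τ fun y => y, integral_mul_gaussKernel, integral_truncGaussian,
    integral_sub_cube_mul_gaussKernel]
  field_simp
  ring

lemma antitone_gaussTail_mul :
    Antitone fun τ => gaussTail τ * (2 * (gaussKernel τ / gaussTail τ) ^ 2 -
      3 * τ * (gaussKernel τ / gaussTail τ) + τ ^ 2 - 1) := by
  have hd (τ : ℝ) : HasDerivAt (fun τ => gaussTail τ * (2 * (gaussKernel τ / gaussTail τ) ^ 2 -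
      3 * τ * (gaussKernel τ / gaussTail τ) + τ ^ 2 - 1))
      (-(2 * gaussTail τ * (gaussKernel τ / gaussTail τ - τ) *
        (1 + τ * (gaussKernel τ / gaussTail τ) - (gaussKernel τ / gaussTail τ) ^ 2))) τ := by
    have hQ := (gaussTail_pos τ).ne'
    have dQ := hasDerivAt_gaussTail τ
    have dh := (hasDerivAt_gaussKernel τ).div dQ hQ
    have := dQ.mul (((((dh.pow 2).const_mul 2).sub
      (((hasDerivAt_id τ).const_mul 3).mul dh)).add (hasDerivAt_pow 2 τ)).sub_const 1)
    refine this.congr_deriv ?_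
    simp
    field_simp
    ring
  refine antitone_of_deriv_nonpos (fun τ => (hd τ).differentiableAt) fun τ => ?_
  rw [(hd τ).deriv, neg_nonpos]
  have hu : 0 ≤ gaussKernel τ / gaussTail τ - τ := by
    rw [sub_nonneg, le_div_iff₀ (gaussTail_pos τ)]
    exact mul_gaussTail_le τ
  have := gaussTail_pos τ
  have := truncGaussian_variance_nonneg τ
  positivity

/-- A convergent of Laplace's continued fraction bounds the Mills ratio from above. -/
lemma gaussTail_le_mul {τ : ℝ} (hτ : 1 ≤ τ) :
    gaussTail τ ≤ gaussKernel τ *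
      ((τ ^ 4 + 9 * τ ^ 2 + 8) / (τ ^ 5 + 10 * τ ^ 3 + 15 * τ)) := by
  set g : ℝ → ℝ := fun x => gaussKernel x *
    ((x ^ 4 + 9 * x ^ 2 + 8) / (x ^ 5 + 10 * x ^ 3 + 15 * x)) with hg
  set g' : ℝ → ℝ := fun x => -gaussKernel x *
    (1 + 120 / (x ^ 5 + 10 * x ^ 3 + 15 * x) ^ 2) with hg'
  have hd : ∀ x ∈ Ici τ, HasDerivAt g (g' x) x := by
    intro x hx
    have hx0 : 0 < x := by linarith [mem_Ici.1 hx]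
    have hB : x ^ 5 + 10 * x ^ 3 + 15 * x ≠ 0 := by positivity
    have dA : HasDerivAt (fun x : ℝ => x ^ 4 + 9 * x ^ 2 + 8) (4 * x ^ 3 + 18 * x) x :=
      (((hasDerivAt_pow 4 x).add ((hasDerivAt_pow 2 x).const_mul 9)).add_const 8).congr_deriv
        (by simp; ring)
    have dB : HasDerivAt (fun x : ℝ => x ^ 5 + 10 * x ^ 3 + 15 * x)
        (5 * x ^ 4 + 30 * x ^ 2 + 15) x :=
      (((hasDerivAt_pow 5 x).add ((hasDerivAt_pow 3 x).const_mul 10)).add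
        ((hasDerivAt_id x).const_mul 15)).congr_deriv (by simp; ring)
    refine ((hasDerivAt_gaussKernel x).mul (dA.div dB hB)).congr_deriv ?_
    simp only [hg', Pi.div_apply]
    field_simp
    ring
  have hneg : ∀ x ∈ Ioi τ, g' x ≤ 0 := fun x _ =>
    mul_nonpos_of_nonpos_of_nonneg (neg_nonpos.2 (gaussKernel_pos x).le) (by positivity)
  have hlim : Tendsto g atTop (𝓝 0) := by
    refine squeeze_zero' (g := gaussKernel) ?_ ?_ tendsto_gaussKernel
    · filter_upwards [eventually_ge_atTop 0] with x hx
      exact mul_nonneg (gaussKernel_pos x).le (by positivity)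
    · filter_upwards [eventually_ge_atTop 1] with x hx
      refine mul_le_of_le_one_right (gaussKernel_pos x).le ?_
      rw [div_le_one (by positivity)]
      have h2 : x ^ 4 ≤ x ^ 5 := pow_le_pow_right₀ hx (by norm_num)
      have h3 : x ^ 2 ≤ x ^ 3 := pow_le_pow_right₀ hx (by norm_num)
      nlinarith [pow_nonneg (zero_le_one.trans hx) 3]
  have hint := integral_Ioi_of_hasDerivAt_of_nonpos' hd hneg hlim
  have hmono : ∫ x in Ioi τ, g' x ≤ ∫ x in Ioi τ, -gaussKernel x := by
    refine setIntegral_mono_on (integrableOn_Ioi_deriv_of_nonpos' hd hneg hlim)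
      integrable_gaussKernel.neg.integrableOn measurableSet_Ioi fun x _ => ?_
    have : 0 ≤ 120 / (x ^ 5 + 10 * x ^ 3 + 15 * x) ^ 2 := by positivity
    have := mul_nonneg (gaussKernel_pos x).le this
    simp only [hg']
    linarith
  rw [integral_neg, hint] at hmono
  change _ ≤ g τ
  unfold gaussTail
  linarith

lemma skewness_factor_lower_bound {τ : ℝ} (hτ : 2 ≤ τ) :
    2 * τ ^ 4 + 10 * τ ^ 2 - 64 ≤ (τ ^ 4 + 9 * τ ^ 2 + 8) ^ 2 *
      (2 * (gaussKernel τ / gaussTail τ) ^ 2 -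
        3 * τ * (gaussKernel τ / gaussTail τ) + τ ^ 2 - 1) := by
  have hQ := gaussTail_pos τ
  have h0 : 0 < τ := by linarith
  have h := gaussTail_le_mul (show 1 ≤ τ by linarith)
  rw [← mul_div_assoc, le_div_iff₀ (by positivity)] at h
  set r := gaussKernel τ / gaussTail τ with hr
  have hP : gaussKernel τ = r * gaussTail τ := by rw [hr]; field_simp
  have he : 0 ≤ (τ ^ 4 + 9 * τ ^ 2 + 8) * r - τ * (τ ^ 4 + 10 * τ ^ 2 + 15) := by
    rw [hP] at h
    refine nonneg_of_mul_nonneg_right (a := gaussTail τ) ?_ hQ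
    linarith
  set e := (τ ^ 4 + 9 * τ ^ 2 + 8) * r - τ * (τ ^ 4 + 10 * τ ^ 2 + 15) with hedef
  have key : (τ ^ 4 + 9 * τ ^ 2 + 8) ^ 2 * (2 * r ^ 2 - 3 * τ * r + τ ^ 2 - 1) =
      2 * τ ^ 4 + 10 * τ ^ 2 - 64 + (2 * e ^ 2 + τ * e * (τ ^ 4 + 13 * τ ^ 2 + 36)) := by
    rw [hedef]; ring
  rw [key]
  have : 0 ≤ 2 * e ^ 2 + τ * e * (τ ^ 4 + 13 * τ ^ 2 + 36) := by positivity
  linarith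

lemma gaussTail_two_lower_bound : 1 / 3 ^ 5 ≤ gaussTail 2 := by
  have h1 : ∫ _x in Ioc (2 : ℝ) 3, gaussKernel 3 ≤ ∫ x in Ioc (2 : ℝ) 3, gaussKernel x := by
    refine setIntegral_mono_on (integrableOn_const (by simp)) integrable_gaussKernel.integrableOn measurableSet_Ioc
      fun x hx => ?_
    refine Real.exp_le_exp.2 ?_
    nlinarith [hx.1, hx.2]
  have h2 : ∫ x in Ioc (2 : ℝ) 3, gaussKernel x ≤ gaussTail 2 :=
    setIntegral_mono_set integrable_gaussKernel.integrableOn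
      (Eventually.of_forall fun x => (gaussKernel_pos x).le) Ioc_subset_Ioi_self.eventuallyLE
  have h3 : 1 / 3 ^ 5 ≤ gaussKernel 3 := by
    have ha : Real.exp (-5) ≤ gaussKernel 3 := Real.exp_le_exp.2 (by norm_num)
    have hb : Real.exp (-5) = 1 / Real.exp 1 ^ 5 := by
      rw [← Real.exp_nat_mul, Real.exp_neg, one_div]; norm_num
    have hc : Real.exp 1 ^ 5 ≤ 3 ^ 5 :=
      pow_le_pow_left₀ (Real.exp_pos _).le Real.exp_one_lt_three.le 5
    rw [hb] at ha
    exact (one_div_le_one_div_of_le (by positivity) hc).trans ha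
  simp only [integral_const, smul_eq_mul] at h1
  norm_num [Measure.real] at h1
  linarith

theorem stmt6 (τ : ℝ) :
    1 / 10 ^ 10 * Real.exp (-τ ^ 2 / 2) / max 1 (τ ^ 12) ≤
      ∫ x, (x - ∫ y, y ∂truncGaussian τ) ^ 3 ∂truncGaussian τ := by
  rw [truncGaussian_third_central_moment]
  have hP := gaussKernel_pos τ
  have hQ := gaussTail_pos τ
  have hexp : Real.exp (-τ ^ 2 / 2) = gaussKernel τ := rfl
  rw [hexp]
  rcases le_total τ 2 with hτ | hτ
  · have hmono := antitone_gaussTail_mul hτ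
    have h2 := skewness_factor_lower_bound le_rfl
    have h3 := gaussTail_two_lower_bound
    have h4 := gaussTail_le τ
    simp only at hmono
    set G2 := 2 * (gaussKernel 2 / gaussTail 2) ^ 2 -
      3 * 2 * (gaussKernel 2 / gaussTail 2) + 2 ^ 2 - 1
    set G := 2 * (gaussKernel τ / gaussTail τ) ^ 2 -
      3 * τ * (gaussKernel τ / gaussTail τ) + τ ^ 2 - 1
    have h5 : 1 / 450 ≤ G2 := by linarith
    have h6 : 1 / 3 ^ 5 * (1 / 450) ≤ gaussTail τ * G :=
      (mul_le_mul h3 h5 (by norm_num) (gaussTail_pos 2).le).trans hmono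
    have h7 : gaussTail τ ^ 2 ≤ 3 ^ 2 := pow_le_pow_left₀ hQ.le h4 2
    calc 1 / 10 ^ 10 * gaussKernel τ / max 1 (τ ^ 12)
        ≤ 1 / 10 ^ 10 * gaussKernel τ :=
          div_le_self (by positivity) (le_max_left _ _)
      _ ≤ gaussKernel τ * (gaussTail τ * G) / gaussTail τ ^ 2 := by
          rw [le_div_iff₀ (by positivity)]
          nlinarith [mul_le_mul_of_nonneg_left h7 hP.le, mul_le_mul_of_nonneg_left h6 hP.le]
      _ = gaussKernel τ / gaussTail τ * G := by field_simp
  · have h := skewness_factor_lower_bound hτ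
    have hr : τ ≤ gaussKernel τ / gaussTail τ := by
      rw [le_div_iff₀ hQ]; exact mul_gaussTail_le τ
    set G := 2 * (gaussKernel τ / gaussTail τ) ^ 2 -
      3 * τ * (gaussKernel τ / gaussTail τ) + τ ^ 2 - 1
    have ht : 4 ≤ τ ^ 2 := by nlinarith
    have hD : (τ ^ 4 + 9 * τ ^ 2 + 8) ^ 2 ≤ (4 * τ ^ 4) ^ 2 :=
      pow_le_pow_left₀ (by positivity) (by nlinarith) 2
    have hG : 8 / (4 * τ ^ 4) ^ 2 ≤ G := by
      have h8 : 8 ≤ (τ ^ 4 + 9 * τ ^ 2 + 8) ^ 2 * G := by nlinarith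
      have hG0 : 0 < G := by
        by_contra! hcon
        nlinarith [sq_nonneg (τ ^ 4 + 9 * τ ^ 2 + 8)]
      rw [div_le_iff₀ (by positivity)]
      nlinarith
    have hP1 : gaussKernel τ ≤ 1 := Real.exp_le_one_iff.2 (by nlinarith)
    have h12 : τ ^ 8 ≤ τ ^ 12 := pow_le_pow_right₀ (by linarith) (by norm_num)
    calc 1 / 10 ^ 10 * gaussKernel τ / max 1 (τ ^ 12)
        ≤ 1 / 10 ^ 10 * 1 / τ ^ 8 := by
          gcongr
          exact h12.trans (le_max_right _ _)
      _ ≤ 2 * (8 / (4 * τ ^ 4) ^ 2) := by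
          have : 2 * (8 / (4 * τ ^ 4) ^ 2) = 1 / τ ^ 8 := by field_simp; norm_num
          rw [this]
          gcongr
          norm_num
      _ ≤ gaussKernel τ / gaussTail τ * G :=
          mul_le_mul (hτ.trans hr) hG (by positivity) (by positivity)
end
end

section
/- For every t ∈ ℝ: t² − 1 + 2·H(t)² − 3·t·H(t) ≥ 10^{−9} / max(1, t^{12}). -/
open MeasureTheory Real

noncomputable section

/-- The standard normal density `φ(t) = (2π)^{-1/2}·exp(-t²/2)`. -/
noncomputable def stdNormalPDF (t : ℝ) : ℝ :=
  (Real.sqrt (2 * Real.pi))⁻¹ * Real.exp (-t ^ 2 / 2)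

/-- The standard normal cumulative distribution function `Φ`. -/
noncomputable def stdNormalCDF (t : ℝ) : ℝ :=
  ∫ x in Set.Iic t, stdNormalPDF x

/-- The hazard rate (inverse Mills ratio) `H(t) = φ(t)/(1 - Φ(t))` of the standard
normal distribution. -/
noncomputable def hazard (t : ℝ) : ℝ :=
  stdNormalPDF t / (1 - stdNormalCDF t)

lemma continuous_stdNormalPDF : Continuous stdNormalPDF := by
  unfold stdNormalPDF
  fun_prop

lemma stdNormalPDF_pos (t : ℝ) : 0 < stdNormalPDF t := by
  unfold stdNormalPDF
  positivity

lemma stdNormalPDF_eq_gaussianPDFReal :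
    stdNormalPDF = ProbabilityTheory.gaussianPDFReal 0 1 := by
  ext t
  simp [stdNormalPDF, ProbabilityTheory.gaussianPDFReal]

lemma integrable_stdNormalPDF : Integrable stdNormalPDF := by
  rw [stdNormalPDF_eq_gaussianPDFReal]
  exact ProbabilityTheory.integrable_gaussianPDFReal 0 1

lemma integral_stdNormalPDF : ∫ x, stdNormalPDF x = 1 := by
  rw [stdNormalPDF_eq_gaussianPDFReal]
  exact ProbabilityTheory.integral_gaussianPDFReal_eq_one 0 one_ne_zero

lemma hasDerivAt_stdNormalPDF (t : ℝ) :
    HasDerivAt stdNormalPDF (-t * stdNormalPDF t) t := by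
  have h : HasDerivAt (fun x : ℝ => -x ^ 2 / 2) (-t) t := by
    refine (((hasDerivAt_pow 2 t).neg).div_const 2).congr_deriv ?_
    push_cast
    ring
  refine ((h.exp).const_mul (Real.sqrt (2 * Real.pi))⁻¹).congr_deriv ?_
  unfold stdNormalPDF
  ring

lemma hasDerivAt_stdNormalCDF (t : ℝ) : HasDerivAt stdNormalCDF (stdNormalPDF t) t := by
  have h : stdNormalCDF = fun x => stdNormalCDF 0 + ∫ y in (0 : ℝ)..x, stdNormalPDF y := by
    ext x
    have := intervalIntegral.integral_Iic_sub_Iic (a := 0) (b := x)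
      integrable_stdNormalPDF.integrableOn integrable_stdNormalPDF.integrableOn
    unfold stdNormalCDF
    linarith
  rw [h]
  exact (intervalIntegral.integral_hasDerivAt_right
    (continuous_stdNormalPDF.intervalIntegrable _ _)
    (continuous_stdNormalPDF.stronglyMeasurableAtFilter _ _)
    continuous_stdNormalPDF.continuousAt).const_add _

lemma one_sub_stdNormalCDF (t : ℝ) :
    1 - stdNormalCDF t = ∫ x in Set.Ioi t, stdNormalPDF x := by
  have := intervalIntegral.integral_Iic_add_Ioi (b := t)
    integrable_stdNormalPDF.integrableOn integrable_stdNormalPDF.integrableOn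
  rw [integral_stdNormalPDF] at this
  unfold stdNormalCDF
  linarith

lemma stdNormalCDF_nonneg (t : ℝ) : 0 ≤ stdNormalCDF t :=
  integral_nonneg fun x => (stdNormalPDF_pos x).le

lemma one_sub_stdNormalCDF_pos (t : ℝ) : 0 < 1 - stdNormalCDF t := by
  rw [one_sub_stdNormalCDF, setIntegral_pos_iff_support_of_nonneg_ae
    (Filter.Eventually.of_forall fun x => (stdNormalPDF_pos x).le)
    integrable_stdNormalPDF.integrableOn]
  have : Function.support stdNormalPDF = Set.univ :=
    Set.eq_univ_of_forall fun x => (stdNormalPDF_pos x).ne'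
  simp [this]

lemma tendsto_stdNormalCDF_atTop :
    Filter.Tendsto stdNormalCDF Filter.atTop (nhds 1) := by
  rw [← integral_stdNormalPDF]
  exact (aecover_Iic Filter.tendsto_id).integral_tendsto_of_countably_generated
    integrable_stdNormalPDF

lemma stdNormalPDF_le_hazard (t : ℝ) : stdNormalPDF t ≤ hazard t := by
  unfold hazard
  rw [le_div_iff₀ (one_sub_stdNormalCDF_pos t)]
  nlinarith [stdNormalCDF_nonneg t, stdNormalPDF_pos t]

/-- The hazard rate solves the Riccati equation `dH/dx = H (H - x)`. A positive function on a right
half-line whose derivative is at least `r (r - x)` is a lower bound for the hazard rate there. -/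
lemma le_hazard_of_deriv_ge {a : ℝ} {r r' : ℝ → ℝ}
    (hr : ∀ x, a < x → HasDerivAt r (r' x) x) (hpos : ∀ x, a < x → 0 < r x)
    (hsub : ∀ x, a < x → r x * (r x - x) ≤ r' x)
    {t : ℝ} (ht : a < t) :
    r t ≤ hazard t := by
  set D : ℝ → ℝ := fun x => stdNormalPDF x / r x - (1 - stdNormalCDF x) with hD
  have hderiv : ∀ x, a < x → HasDerivAt D
      ((-x * stdNormalPDF x * r x - stdNormalPDF x * r' x) / r x ^ 2 + stdNormalPDF x) x := by
    intro x hx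
    refine (((hasDerivAt_stdNormalPDF x).div (hr x hx) (hpos x hx).ne').sub
      ((hasDerivAt_stdNormalCDF x).const_sub 1)).congr_deriv ?_
    ring
  have hanti : AntitoneOn D (Set.Ioi a) := by
    apply antitoneOn_of_deriv_nonpos (convex_Ioi a)
    · exact fun x hx => (hderiv x hx).continuousAt.continuousWithinAt
    · intro x hx
      rw [interior_Ioi] at hx
      exact (hderiv x hx).differentiableAt.differentiableWithinAt
    · intro x hx
      rw [interior_Ioi] at hx
      rw [(hderiv x hx).deriv]
      have h1 := hpos x hx
      have h2 : (-x * stdNormalPDF x * r x - stdNormalPDF x * r' x) / r x ^ 2 + stdNormalPDF x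
          = stdNormalPDF x * (r x * (r x - x) - r' x) / r x ^ 2 := by
        field_simp
        ring
      rw [h2]
      exact div_nonpos_of_nonpos_of_nonneg
        (mul_nonpos_of_nonneg_of_nonpos (stdNormalPDF_pos x).le (by linarith [hsub x hx]))
        (by positivity)
  have hlower : ∀ᶠ x in Filter.atTop, -(1 - stdNormalCDF x) ≤ D t := by
    filter_upwards [Filter.eventually_ge_atTop t] with x hx
    have hax : a < x := lt_of_lt_of_le ht hx
    have h1 : D x ≤ D t := hanti ht hax hx
    have h2 : 0 < stdNormalPDF x / r x := div_pos (stdNormalPDF_pos x) (hpos x hax)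
    simp only [hD] at h1 ⊢
    linarith
  have hlim : Filter.Tendsto (fun x => -(1 - stdNormalCDF x)) Filter.atTop (nhds 0) := by
    simpa using (tendsto_stdNormalCDF_atTop.const_sub 1).neg
  have hDt : 0 ≤ D t := le_of_tendsto hlim hlower
  have hS := one_sub_stdNormalCDF_pos t
  have hrt := hpos t ht
  unfold hazard
  rw [le_div_iff₀ hS]
  have : 1 - stdNormalCDF t ≤ stdNormalPDF t / r t := by
    simp only [hD] at hDt
    linarith
  rw [le_div_iff₀ hrt] at this
  linarith

/-- The perturbed Sampford discriminant. -/
def sampfordDisc (x : ℝ) : ℝ := x ^ 2 + 8 + 1 / (1000 * (1 + x ^ 2) ^ 2)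

lemma lt_sampfordDisc (x : ℝ) : x ^ 2 + 8 < sampfordDisc x := by
  unfold sampfordDisc
  have : 0 < 1 / (1000 * (1 + x ^ 2) ^ 2) := by positivity
  linarith

lemma hasDerivAt_sampfordDisc (x : ℝ) :
    HasDerivAt sampfordDisc (2 * x - 4 * x / (1000 * (1 + x ^ 2) ^ 3)) x := by
  have h1 := (((hasDerivAt_pow 2 x).const_add 1).pow 2).const_mul 1000
  have hne : 1000 * (1 + x ^ 2) ^ 2 ≠ 0 := by positivity
  have h2 := ((hasDerivAt_pow 2 x).add_const 8).add (h1.inv hne)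
  refine (h2.congr_deriv ?_).congr_of_eventuallyEq (Filter.Eventually.of_forall fun y => ?_)
  · have : 1 + x ^ 2 ≠ 0 := by positivity
    simp only [Pi.pow_apply]
    push_cast
    field_simp
    ring
  · simp [sampfordDisc]

lemma sampford_polynomial_ineq (T : ℝ) (hT : 0 ≤ T) :
    T * (T + 6 + 1 / (1000 * (1 + T) ^ 2) + 4 / (1000 * (1 + T) ^ 3)) ^ 2 ≤
      (T + 8 + 1 / (1000 * (1 + T) ^ 2)) * (T + 2 - 1 / (1000 * (1 + T) ^ 2) / 2) ^ 2 := by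
  set e : ℝ := 1 / (1000 * (1 + T) ^ 2) with he
  set d : ℝ := 4 / (1000 * (1 + T) ^ 3) with hd
  have he0 : 0 < e := by positivity
  have hd0 : 0 < d := by positivity
  have heT : e * (1 + T) ^ 2 = 1 / 1000 := by rw [he]; field_simp
  have hde : d ≤ 4 * e := by
    rw [show 4 * e = d * (1 + T) by rw [he, hd]; field_simp]
    nlinarith [mul_nonneg hd0.le hT]
  have h1 : 0 ≤ e * T := by positivity
  have h2 : 0 ≤ e * T ^ 2 := by positivity
  have h3 : e ≤ 1 / 1000 := by linarith
  have h4 : e * T ≤ 1 / 1000 := by linarith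
  have h5 : e * T ^ 2 ≤ 1 / 1000 := by linarith
  have h6 : T * (T + 6) * (e + d) ≤ T * (T + 6) * (5 * e) := by gcongr; linarith
  have h7 : T * (e + d) ^ 2 ≤ T * (5 * e) ^ 2 := by gcongr; linarith
  have h8 : e * T * e ≤ 1 / 1000 * (1 / 1000) := by gcongr
  have h9 : e * e ≤ 1 / 1000 * (1 / 1000) := by gcongr
  have h10 : 0 ≤ (T + 8 + e) * e ^ 2 := by positivity
  linarith

lemma sampford_subsolution (x s : ℝ) (hs : 0 < s) (hs2 : s ^ 2 = sampfordDisc x) :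
    (3 * x + s) / 4 * ((3 * x + s) / 4 - x) ≤
      (3 + (2 * x - 4 * x / (1000 * (1 + x ^ 2) ^ 3)) / (2 * s)) / 4 := by
  set e : ℝ := 1 / (1000 * (1 + x ^ 2) ^ 2) with he
  set d : ℝ := 4 / (1000 * (1 + x ^ 2) ^ 3) with hd
  have hd' : 4 * x / (1000 * (1 + x ^ 2) ^ 3) = x * d := by rw [hd]; ring
  have he1 : e ≤ 1 := by
    rw [he, div_le_one (by positivity)]
    nlinarith [sq_nonneg x, sq_nonneg (x ^ 2)]
  have hss : s ^ 2 = x ^ 2 + 8 + e := hs2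
  have hpoly : x ^ 2 * (x ^ 2 + 6 + e + d) ^ 2 ≤ (x ^ 2 + 8 + e) * (x ^ 2 + 2 - e / 2) ^ 2 :=
    sampford_polynomial_ineq (x ^ 2) (sq_nonneg x)
  have hA : 0 ≤ x ^ 2 + 2 - e / 2 := by nlinarith [sq_nonneg x]
  have key : x * (x ^ 2 + 6 + e + d) ≤ s * (x ^ 2 + 2 - e / 2) := by
    apply le_of_sq_le_sq _ (by positivity)
    rw [mul_pow, mul_pow, hss]
    exact hpoly
  rw [hd']
  have h : (3 + (2 * x - x * d) / (2 * s)) / 4 - (3 * x + s) / 4 * ((3 * x + s) / 4 - x) =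
      (s * (x ^ 2 + 2 - e / 2) - x * (x ^ 2 + 6 + e + d)) / (8 * s) := by
    clear_value e d
    field_simp
    linear_combination (-16 * s - 32 * x) * hss
  have := div_nonneg (sub_nonneg.2 key) (by positivity : 0 ≤ 8 * s)
  linarith

lemma sampford_le_hazard {t : ℝ} (ht : -1 < t) :
    (3 * t + √(sampfordDisc t)) / 4 ≤ hazard t := by
  have hd : ∀ x, 0 < sampfordDisc x := fun x => by nlinarith [lt_sampfordDisc x, sq_nonneg x]
  have hs : ∀ x, 0 < √(sampfordDisc x) := fun x => Real.sqrt_pos.2 (hd x)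
  refine le_hazard_of_deriv_ge (a := -1) (r := fun x => (3 * x + √(sampfordDisc x)) / 4)
    (fun x _ => ((((hasDerivAt_id x).const_mul 3).add
      ((hasDerivAt_sampfordDisc x).sqrt (hd x).ne')).div_const 4)) ?_ ?_ ht
  · intro x hx
    have h2 := Real.sq_sqrt (hd x).le
    have := lt_sampfordDisc x
    have : 0 < 3 * x + √(sampfordDisc x) := by
      by_contra! hneg
      nlinarith [hs x]
    positivity
  · intro x _
    have := sampford_subsolution x _ (hs x) (Real.sq_sqrt (hd x).le)
    simpa using this

lemma one_add_sq_sq_le (t : ℝ) : (1 + t ^ 2) ^ 2 ≤ 4 * max 1 (t ^ 12) := by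
  rcases le_total (t ^ 2) 1 with h | h
  · have := le_max_left 1 (t ^ 12)
    nlinarith [sq_nonneg t]
  · have h4 : (t ^ 2) ^ 2 ≤ (t ^ 2) ^ 6 := pow_le_pow_right₀ h (by norm_num)
    have := le_max_right 1 (t ^ 12)
    nlinarith

theorem stmt8 (t : ℝ) :
    1 / 10 ^ 9 / max 1 (t ^ 12) ≤ t ^ 2 - 1 + 2 * hazard t ^ 2 - 3 * t * hazard t := by
  have hm1 : 1 ≤ max 1 (t ^ 12) := le_max_left _ _
  rcases lt_or_ge (-1) t with ht | ht
  · have h := sampford_le_hazard ht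
    have hd : 0 ≤ sampfordDisc t := by nlinarith [lt_sampfordDisc t, sq_nonneg t]
    have h1 : √(sampfordDisc t) ≤ 4 * hazard t - 3 * t := by linarith
    have h2 : sampfordDisc t ≤ (4 * hazard t - 3 * t) ^ 2 := by
      rw [← Real.sq_sqrt hd]
      gcongr
    have h3 : 1 / 10 ^ 9 / max 1 (t ^ 12) ≤ 1 / (1000 * (1 + t ^ 2) ^ 2) / 8 := by
      rw [div_div, div_div]
      apply one_div_le_one_div_of_le (by positivity)
      linarith [one_add_sq_sq_le t]
    unfold sampfordDisc at h2
    linarith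
  · have hH := stdNormalPDF_le_hazard t
    have hp := stdNormalPDF_pos t
    have h0 : 1 / 10 ^ 9 / max 1 (t ^ 12) ≤ 1 / 10 ^ 9 := div_le_self (by norm_num) hm1
    refine h0.trans ?_
    rcases lt_or_ge t (-2) with ht2 | ht2
    · nlinarith
    · have hlow : 1 / 10 ^ 3 ≤ stdNormalPDF t := by
        have hexp : 1 / 9 ≤ Real.exp (-t ^ 2 / 2) := by
          have h9 : Real.exp 2 ≤ 9 := by
            rw [show (2 : ℝ) = 1 + 1 by norm_num, Real.exp_add]
            nlinarith [Real.exp_one_lt_three, Real.exp_pos 1]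
          have h2 : Real.exp (-2) ≤ Real.exp (-t ^ 2 / 2) := by
            gcongr
            nlinarith
          refine le_trans ?_ h2
          rw [Real.exp_neg, one_div]
          gcongr
        have hsqrt : √(2 * Real.pi) ≤ 3 := by
          rw [Real.sqrt_le_left (by norm_num)]
          linarith [Real.pi_lt_four]
        have hinv : 1 / 3 ≤ (√(2 * Real.pi))⁻¹ := by
          rw [one_div]
          gcongr
        unfold stdNormalPDF
        nlinarith
      nlinarith
end
end

section
/- The following two explicit inequalities hold: (a) for every real t ≥ 6/5, t² − 1 + 2·H₁(t)² − 3·t·H₁(t) ≥ (9/(10⁴·156²))·t^{−12}; and (b) for every real t with 0 < t ≤ 6/5, t² − 1 + 2·H₂(t)² − 3·t·H₂(t) ≥ 1/250. -/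
open Real

noncomputable section

/-- The first Gasull–Utzet lower bound for the hazard rate. -/
noncomputable def H1 (t : ℝ) : ℝ :=
  (t ^ 7 + 21 * t ^ 5 + 105 * t ^ 3 + 105 * t) / (t ^ 6 + 20 * t ^ 4 + 87 * t ^ 2 + 48)

/-- The second Gasull–Utzet lower bound for the hazard rate. -/
noncomputable def H2 (t : ℝ) : ℝ :=
  (2 * t + Real.sqrt ((Real.pi - 2) ^ 2 * t ^ 2 + 2 * Real.pi)) / Real.pi

/-- The quadratic form in the hazard-rate bound `H1` has numerator of low degree after cancellation. -/
theorem quadratic_H1_eq {t : ℝ} :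
    t ^ 2 - 1 + 2 * H1 t ^ 2 - 3 * t * H1 t =
      (2 * t ^ 8 + 54 * t ^ 6 + 438 * t ^ 4 + 882 * t ^ 2 - 2304) /
        (t ^ 6 + 20 * t ^ 4 + 87 * t ^ 2 + 48) ^ 2 := by
  have hd : t ^ 6 + 20 * t ^ 4 + 87 * t ^ 2 + 48 ≠ 0 := by positivity
  unfold H1
  field_simp
  ring

theorem le_quadratic_H1 {t : ℝ} (ht : 6 / 5 ≤ t) :
    9 / (10 ^ 4 * 156 ^ 2) / t ^ 12 ≤ t ^ 2 - 1 + 2 * H1 t ^ 2 - 3 * t * H1 t := by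
  have ht0 : 0 < t := by linarith
  obtain ⟨u, hu, hut⟩ : ∃ u : ℝ, 0 ≤ u ∧ t ^ 2 = u + 36 / 25 :=
    ⟨t ^ 2 - 36 / 25, by nlinarith, by ring⟩
  rw [quadratic_H1_eq, div_le_div_iff₀ (by positivity) (by positivity),
    show t ^ 12 = (t ^ 2) ^ 6 by ring, show t ^ 8 = (t ^ 2) ^ 4 by ring,
    show t ^ 6 = (t ^ 2) ^ 3 by ring, show t ^ 4 = (t ^ 2) ^ 2 by ring, hut, ← sub_nonneg]
  ring_nf
  positivity

/-- A linear-plus-reciprocal upper bound for the square root occurring in `H2`. -/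
theorem sqrt_mul_le {t : ℝ} (ht0 : 0 < t) (ht : t ≤ 6 / 5) :
    t * √((π - 2) ^ 2 * t ^ 2 + 2 * π) ≤ (π - 2) * t ^ 2 + 91 / 50 := by
  have h₁ := pi_gt_d4
  have h₂ := pi_lt_d4
  have ht2 : t ^ 2 ≤ 36 / 25 := by nlinarith
  have hc : (2 * π - 91 / 25 * (π - 2)) * t ^ 2 ≤ (91 / 50) ^ 2 := by nlinarith
  refine abs_le_of_sq_le_sq' ?_ (by nlinarith [sq_nonneg t]) |>.2
  rw [mul_pow, sq_sqrt (by positivity)]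
  linarith

theorem le_quadratic_H2 {t : ℝ} (ht0 : 0 < t) (ht : t ≤ 6 / 5) :
    1 / 250 ≤ t ^ 2 - 1 + 2 * H2 t ^ 2 - 3 * t * H2 t := by
  have h₁ := pi_gt_d4
  have h₂ := pi_lt_d4
  have hr := sqrt_mul_le ht0 ht
  have hs : √((π - 2) ^ 2 * t ^ 2 + 2 * π) ^ 2 = (π - 2) ^ 2 * t ^ 2 + 2 * π :=
    sq_sqrt (by positivity)
  unfold H2
  set r := √((π - 2) ^ 2 * t ^ 2 + 2 * π)
  have hq : t ^ 2 - 1 + 2 * ((2 * t + r) / π) ^ 2 - 3 * t * ((2 * t + r) / π) =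
      ((3 * π - 8) * ((π - 2) * t ^ 2 - t * r) + 4 * π - π ^ 2) / π ^ 2 := by
    field_simp
    linear_combination 2 * hs
  rw [hq, le_div_iff₀ (by positivity)]
  nlinarith [mul_le_mul_of_nonneg_left hr (show 0 ≤ 3 * π - 8 by linarith)]

theorem stmt10 :
    (∀ t : ℝ, 6 / 5 ≤ t →
      9 / (10 ^ 4 * 156 ^ 2) / t ^ 12 ≤ t ^ 2 - 1 + 2 * H1 t ^ 2 - 3 * t * H1 t) ∧
    (∀ t : ℝ, 0 < t → t ≤ 6 / 5 →
      1 / 250 ≤ t ^ 2 - 1 + 2 * H2 t ^ 2 - 3 * t * H2 t) :=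
  ⟨fun _ ht => le_quadratic_H1 ht, fun _ ht0 ht => le_quadratic_H2 ht0 ht⟩
end
end

section
/- For every t ≤ 0: t² − 1 + 2·H(t)² − 3·t·H(t) ≥ 1/125. -/
open MeasureTheory Real

noncomputable section

lemma integrable_exp_neg_sq_div_two : Integrable fun x : ℝ => Real.exp (-x ^ 2 / 2) := by
  refine (integrable_exp_neg_mul_sq (b := 1 / 2) (by norm_num)).congr (.of_forall fun x => ?_)
  ring_nf

lemma integral_exp_neg_sq_div_two : ∫ x : ℝ, Real.exp (-x ^ 2 / 2) = √(2 * π) := by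
  have h := integral_gaussian (1 / 2)
  rw [show π / (1 / 2) = 2 * π by ring] at h
  rw [← h]
  congr with x
  ring_nf

lemma integral_Ioi_zero_exp_neg_sq_div_two :
    ∫ x in Set.Ioi (0 : ℝ), Real.exp (-x ^ 2 / 2) = √(2 * π) / 2 := by
  have h := integral_gaussian_Ioi (1 / 2)
  rw [show π / (1 / 2) = 2 * π by ring] at h
  rw [← h]
  congr with x
  ring_nf

lemma one_sub_stdNormalCDF_s11 (t : ℝ) :
    1 - stdNormalCDF t = (√(2 * π))⁻¹ * ∫ x in Set.Ioi t, Real.exp (-x ^ 2 / 2) := by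
  have h := intervalIntegral.integral_Iic_add_Ioi (b := t)
    integrable_exp_neg_sq_div_two.integrableOn integrable_exp_neg_sq_div_two.integrableOn
  rw [integral_exp_neg_sq_div_two] at h
  have hpos : √(2 * π) ≠ 0 := by positivity
  simp only [stdNormalCDF, stdNormalPDF, integral_const_mul]
  rw [eq_sub_of_add_eq' h, mul_sub, inv_mul_cancel₀ hpos]

lemma hazard_eq (t : ℝ) :
    hazard t = Real.exp (-t ^ 2 / 2) / ∫ x in Set.Ioi t, Real.exp (-x ^ 2 / 2) := by
  have hpos : (√(2 * π))⁻¹ ≠ 0 := by positivity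
  rw [hazard, one_sub_stdNormalCDF_s11, stdNormalPDF, mul_div_mul_left _ _ hpos]

lemma integral_Ioi_exp_neg_sq_div_two_pos (t : ℝ) :
    0 < ∫ x in Set.Ioi t, Real.exp (-x ^ 2 / 2) := by
  rw [setIntegral_pos_iff_support_of_nonneg_ae (.of_forall fun x => (Real.exp_pos _).le)
    integrable_exp_neg_sq_div_two.integrableOn]
  have h : Function.support (fun x : ℝ => Real.exp (-x ^ 2 / 2)) = Set.univ :=
    Set.eq_univ_of_forall fun x => (Real.exp_pos _).ne'
  simp [h]

lemma integral_Ioi_exp_neg_sq_div_two_le {t : ℝ} (ht : t ≤ 0) :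
    ∫ x in Set.Ioi t, Real.exp (-x ^ 2 / 2) ≤ √(2 * π) / 2 - t := by
  rw [← Set.Ioc_union_Ioi_eq_Ioi ht,
    setIntegral_union (Set.Ioc_disjoint_Ioi le_rfl) measurableSet_Ioi
      integrable_exp_neg_sq_div_two.integrableOn integrable_exp_neg_sq_div_two.integrableOn,
    integral_Ioi_zero_exp_neg_sq_div_two]
  have h : ∫ x in Set.Ioc t 0, Real.exp (-x ^ 2 / 2) ≤ ∫ _ in Set.Ioc t 0, (1 : ℝ) := by
    refine setIntegral_mono integrable_exp_neg_sq_div_two.integrableOn (by simp) fun x => ?_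
    exact Real.exp_le_one_iff.2 (by nlinarith [sq_nonneg x])
  have h_len : ∫ _ in Set.Ioc t 0, (1 : ℝ) = -t := by simp [ht]
  linarith

lemma hazard_pos (t : ℝ) : 0 < hazard t := by
  rw [hazard_eq]
  exact div_pos (Real.exp_pos _) (integral_Ioi_exp_neg_sq_div_two_pos t)

lemma sqrt_two_mul_pi_div_two_le : √(2 * π) / 2 ≤ 63 / 50 := by
  have h : √(2 * π) ≤ 63 / 25 :=
    Real.sqrt_le_iff.2 ⟨by norm_num, by nlinarith [Real.pi_lt_d2]⟩
  linarith

lemma one_sub_sq_div_two_le_hazard_mul {t : ℝ} (ht : t ≤ 0) :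
    1 - t ^ 2 / 2 ≤ hazard t * (63 / 50 - t) := by
  have hG := integral_Ioi_exp_neg_sq_div_two_pos t
  have hle := (integral_Ioi_exp_neg_sq_div_two_le ht).trans
    (sub_le_sub_right sqrt_two_mul_pi_div_two_le t)
  calc 1 - t ^ 2 / 2 ≤ Real.exp (-t ^ 2 / 2) := by linarith [Real.add_one_le_exp (-t ^ 2 / 2)]
    _ = hazard t * ∫ x in Set.Ioi t, Real.exp (-x ^ 2 / 2) := by
      rw [hazard_eq, div_mul_cancel₀ _ hG.ne']
    _ ≤ hazard t * (63 / 50 - t) := mul_le_mul_of_nonneg_left hle (hazard_pos t).le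

theorem stmt11 (t : ℝ) (ht : t ≤ 0) :
    1 / 125 ≤ t ^ 2 - 1 + 2 * hazard t ^ 2 - 3 * t * hazard t := by
  have hH := hazard_pos t
  have hb := one_sub_sq_div_two_le_hazard_mul ht
  generalize hazard t = H at hH hb ⊢
  obtain ⟨s, rfl⟩ : ∃ s, t = -s := ⟨-t, by ring⟩
  have hs : 0 ≤ s := by linarith
  have hsH : 0 ≤ s * H := by positivity
  rcases le_or_gt (126 / 125) (s ^ 2) with h | h
  · nlinarith [sq_nonneg H]
  have ha : 0 < 63 / 50 + s := by linarith
  have hs1 : s ≤ 101 / 100 := by nlinarith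
  have hu : 0 < 1 - s ^ 2 / 2 := by linarith
  have hm : 1 - s ^ 2 / 2 ≤ H * (63 / 50 + s) := by linarith [hb]
  have hsq : (1 - s ^ 2 / 2) ^ 2 ≤ (H * (63 / 50 + s)) ^ 2 := by gcongr
  have hlin : s * (63 / 50 + s) * (1 - s ^ 2 / 2)
      ≤ s * (63 / 50 + s) * (H * (63 / 50 + s)) := by gcongr
  have hpoly : (126 / 125 - s ^ 2) * (63 / 50 + s) ^ 2
      ≤ 2 * (1 - s ^ 2 / 2) ^ 2 + 3 * (s * (63 / 50 + s) * (1 - s ^ 2 / 2)) := by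
    nlinarith [mul_nonneg hs hs, mul_nonneg hs (sub_nonneg.2 hs1),
      mul_nonneg (mul_nonneg hs hs) (sub_nonneg.2 hs1), sq_nonneg (s - 1 / 4)]
  have hfin : (126 / 125 - s ^ 2) * (63 / 50 + s) ^ 2
      ≤ (2 * H ^ 2 + 3 * s * H) * (63 / 50 + s) ^ 2 := by linarith
  have := le_of_mul_le_mul_right hfin (by positivity)
  linarith
end
end

section
/- Let Σ be an invertible symmetric d×d real matrix, let w, μ ∈ ℝ^d and b ∈ ℝ. Define the (d+1)×(d+1) block matrix Σ̄ with blocks [[Σ, Σw], [(Σw)ᵀ, wᵀΣw + 1]] and the vector μ̄ := (μ, μᵀw + b) ∈ ℝ^{d+1}. Then Σ̄ is invertible with Σ̄^{−1} equal to the block matrix [[Σ^{−1} + w·wᵀ, −w], [−wᵀ, 1]], and Σ̄^{−1}·μ̄ = (Σ^{−1}μ − b·w, b). -/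
open Matrix

noncomputable section

/-- The block matrix `Σ̄ = [[Σ, Σw], [(Σw)ᵀ, wᵀΣw + 1]]`. -/
noncomputable def blockSigma {d : ℕ} (A : Matrix (Fin d) (Fin d) ℝ) (w : Fin d → ℝ) :
    Matrix (Fin d ⊕ Unit) (Fin d ⊕ Unit) ℝ :=
  Matrix.fromBlocks A
    (Matrix.of fun i (_ : Unit) => (A *ᵥ w) i)
    (Matrix.of fun (_ : Unit) j => (A *ᵥ w) j)
    (Matrix.of fun (_ : Unit) (_ : Unit) => w ⬝ᵥ (A *ᵥ w) + 1)

/-- The claimed inverse `[[Σ⁻¹ + w·wᵀ, −w], [−wᵀ, 1]]`. -/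
noncomputable def blockSigmaInv {d : ℕ} (A : Matrix (Fin d) (Fin d) ℝ) (w : Fin d → ℝ) :
    Matrix (Fin d ⊕ Unit) (Fin d ⊕ Unit) ℝ :=
  Matrix.fromBlocks (A⁻¹ + Matrix.vecMulVec w w)
    (Matrix.of fun i (_ : Unit) => -w i)
    (Matrix.of fun (_ : Unit) j => -w j)
    (Matrix.of fun (_ : Unit) (_ : Unit) => (1 : ℝ))

theorem blockSigma_mul_blockSigmaInv {d : ℕ} {A : Matrix (Fin d) (Fin d) ℝ} (hsym : A.IsSymm)
    (hinv : IsUnit A.det) (w : Fin d → ℝ) : blockSigma A w * blockSigmaInv A w = 1 := by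
  have hw : (A *ᵥ w) ᵥ* A⁻¹ = w := by
    rw [← vecMul_transpose, hsym.eq, vecMul_vecMul, mul_nonsing_inv _ hinv, vecMul_one]
  rw [blockSigma, blockSigmaInv, fromBlocks_multiply, ← fromBlocks_one]
  congr 1
  · rw [mul_add, mul_nonsing_inv _ hinv, mul_vecMulVec]
    ext i j
    simp [mul_apply, vecMulVec_apply]
  · ext i j
    simp [mul_apply, mulVec, dotProduct]
  · ext i j
    have h : ((A *ᵥ w) ᵥ* (A⁻¹ + vecMulVec w w)) j = w j + (w ⬝ᵥ (A *ᵥ w)) * w j := by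
      rw [vecMul_add, hw, vecMul_vecMulVec, dotProduct_comm]
      simp
    rw [vecMul, dotProduct] at h
    simp only [Matrix.add_apply, mul_apply, of_apply] at h ⊢
    rw [h]
    simp
    ring
  · ext i j
    simp [mul_apply, dotProduct, mul_comm]

theorem stmt13 {d : ℕ} (A : Matrix (Fin d) (Fin d) ℝ) (hsym : A.IsSymm)
    (hinv : IsUnit A.det) (w μ : Fin d → ℝ) (b : ℝ) :
    IsUnit (blockSigma A w).det ∧
      (blockSigma A w)⁻¹ = blockSigmaInv A w ∧
      (blockSigma A w)⁻¹ *ᵥ Sum.elim μ (fun _ : Unit => μ ⬝ᵥ w + b) =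
        Sum.elim (A⁻¹ *ᵥ μ - b • w) (fun _ : Unit => b) := by
  have hmul := blockSigma_mul_blockSigmaInv hsym hinv w
  have hInv : (blockSigma A w)⁻¹ = blockSigmaInv A w := inv_eq_right_inv hmul
  refine ⟨isUnit_det_of_right_inverse hmul, hInv, ?_⟩
  rw [hInv, blockSigmaInv, fromBlocks_mulVec, Sum.elim_comp_inl, Sum.elim_comp_inr]
  congr 1
  · rw [add_mulVec, vecMulVec_mulVec]
    ext i
    simp [mulVec, dotProduct, mul_comm]
    ring
  · ext i
    simp [mulVec, dotProduct, mul_comm]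
end
end

section
/- Let Σ be a symmetric positive definite d×d real matrix and μ ∈ ℝ^d. Then: (i) M(μ,Σ)·Σ^{−1}·M(μ,Σ)ᵀ = B(μ,Σ), and in particular B(μ,Σ) is positive semidefinite; and (ii) the (d+d²)×(d+d²) symmetric block matrix with blocks [[Σ, (1/2)·M(μ,Σ)ᵀ], [(1/2)·M(μ,Σ), B(μ,Σ)]] is positive semidefinite. -/
open Matrix

noncomputable section

/-- The `d²×d` matrix `M(μ,Σ) = μ⊗Σ + Σ⊗μ`, with entries
`M_{(i,j),k} = μ_i·Σ_{jk} + Σ_{ik}·μ_j`. -/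
noncomputable def Mmat {d : ℕ} (μ : Fin d → ℝ) (A : Matrix (Fin d) (Fin d) ℝ) :
    Matrix (Fin d × Fin d) (Fin d) ℝ :=
  Matrix.of fun p k => μ p.1 * A p.2 k + A p.1 k * μ p.2

/-- The `d²×d²` matrix `B(μ,Σ) = μμᵀ⊗Σ + μ⊗Σ⊗μᵀ + μᵀ⊗Σ⊗μ + Σ⊗μμᵀ`, with entries
`B_{(i,j),(k,l)} = μ_i·μ_k·Σ_{jl} + μ_i·μ_l·Σ_{jk} + μ_j·μ_k·Σ_{il} + μ_j·μ_l·Σ_{ik}`. -/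
noncomputable def Bmat {d : ℕ} (μ : Fin d → ℝ) (A : Matrix (Fin d) (Fin d) ℝ) :
    Matrix (Fin d × Fin d) (Fin d × Fin d) ℝ :=
  Matrix.of fun p q =>
    μ p.1 * μ q.1 * A p.2 q.2 + μ p.1 * μ q.2 * A p.2 q.1
      + μ p.2 * μ q.1 * A p.1 q.2 + μ p.2 * μ q.2 * A p.1 q.1

/-- The `d²×d` matrix `μ⊗I + I⊗μ`, which factors `Mmat μ A` as a left multiple of `A`. -/
def symTensor {d : ℕ} (μ : Fin d → ℝ) : Matrix (Fin d × Fin d) (Fin d) ℝ :=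
  Mmat μ 1

theorem symTensor_mul_apply {d : ℕ} {n : Type*} (μ : Fin d → ℝ) (X : Matrix (Fin d) n ℝ)
    (p : Fin d × Fin d) (q : n) :
    (symTensor μ * X) p q = μ p.1 * X p.2 q + μ p.2 * X p.1 q := by
  simp [symTensor, Mmat, Matrix.mul_apply, Matrix.one_apply, add_mul, Finset.sum_add_distrib]

theorem symTensor_mul {d : ℕ} (μ : Fin d → ℝ) (A : Matrix (Fin d) (Fin d) ℝ) :
    symTensor μ * A = Mmat μ A := by
  ext p k
  rw [symTensor_mul_apply]
  simp [Mmat, mul_comm]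

theorem Mmat_mul_inv_mul_transpose {d : ℕ} {A : Matrix (Fin d) (Fin d) ℝ} (hA : A.PosDef)
    (μ : Fin d → ℝ) : Mmat μ A * A⁻¹ * (Mmat μ A)ᵀ = Bmat μ A := by
  have hdet : IsUnit A.det := (Matrix.isUnit_iff_isUnit_det A).mp hA.isUnit
  have hsymm (i j : Fin d) : A i j = A j i := by simpa using hA.isHermitian.apply j i
  rw [← symTensor_mul, Matrix.mul_nonsing_inv_cancel_right _ _ hdet, symTensor_mul]
  ext p q
  rw [symTensor_mul_apply]
  simp only [Mmat, Bmat, Matrix.transpose_apply, Matrix.of_apply]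
  rw [hsymm q.1 p.1, hsymm q.1 p.2, hsymm q.2 p.1, hsymm q.2 p.2]
  ring

theorem Bmat_posSemidef {d : ℕ} {A : Matrix (Fin d) (Fin d) ℝ} (hA : A.PosDef)
    (μ : Fin d → ℝ) : (Bmat μ A).PosSemidef := by
  rw [← Mmat_mul_inv_mul_transpose hA, ← Matrix.conjTranspose_eq_transpose_of_trivial]
  exact hA.posSemidef.inv.mul_mul_conjTranspose_same _

theorem stmt14 {d : ℕ} (A : Matrix (Fin d) (Fin d) ℝ) (hA : A.PosDef) (μ : Fin d → ℝ) :
    Mmat μ A * A⁻¹ * (Mmat μ A)ᵀ = Bmat μ A ∧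
      (Bmat μ A).PosSemidef ∧
      (Matrix.fromBlocks A ((1 / 2 : ℝ) • (Mmat μ A)ᵀ) ((1 / 2 : ℝ) • Mmat μ A)
          (Bmat μ A)).PosSemidef := by
  refine ⟨Mmat_mul_inv_mul_transpose hA μ, Bmat_posSemidef hA μ, ?_⟩
  have hblock : (1 / 2 : ℝ) • Mmat μ A = ((1 / 2 : ℝ) • (Mmat μ A)ᵀ)ᴴ := by
    simp [Matrix.conjTranspose_eq_transpose_of_trivial]
  have : Invertible A := hA.isUnit.invertible
  rw [hblock, hA.fromBlocks₁₁, ← hblock]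
  have hschur : Bmat μ A - (1 / 2 : ℝ) • Mmat μ A * A⁻¹ * (1 / 2 : ℝ) • (Mmat μ A)ᵀ
      = (3 / 4 : ℝ) • Bmat μ A := by
    rw [Matrix.smul_mul, Matrix.smul_mul, Matrix.mul_smul, Mmat_mul_inv_mul_transpose hA]
    module
  rw [hschur]
  exact (Bmat_posSemidef hA μ).smul (by norm_num)
end
end

section
/- Let Σ be a symmetric positive definite d×d real matrix with largest eigenvalue λ_max, let μ ∈ ℝ^d, and set K := max(λ_max, λ_max²). Then the (d+d²)×(d+d²) symmetric block matrix with blocks [[Σ, −(1/2)·M(μ,Σ)ᵀ], [−(1/2)·M(μ,Σ), Q(μ,Σ)]] is ⪯ 7·(1 + ‖μ‖₂²)·K·I in the Loewner order (i.e., 7·(1+‖μ‖₂²)·K·I minus this block matrix is positive semidefinite). This block matrix is the covariance matrix of the sufficient statistic t(x) = (x, −x·xᵀ) of the Gaussian distribution N(μ,Σ). -/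
open Matrix

noncomputable section

/-- The `d²×d²` matrix `Q(μ,Σ) = (1/2)·(Σ⊗Σ) + (1/4)·B(μ,Σ)`, with entries
`Q_{(i,j),(k,l)} = (1/2)·Σ_{ik}·Σ_{jl} + (1/4)·B_{(i,j),(k,l)}`. -/
noncomputable def Qmat {d : ℕ} (μ : Fin d → ℝ) (A : Matrix (Fin d) (Fin d) ℝ) :
    Matrix (Fin d × Fin d) (Fin d × Fin d) ℝ :=
  Matrix.of fun p q => (1 / 2) * A p.1 q.1 * A p.2 q.2 + (1 / 4) * Bmat μ A p q

open scoped MatrixOrder in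
/-- A Hermitian matrix whose eigenvalues are at most `c` lies below `c • 1` in the Loewner order. -/
theorem Matrix.IsHermitian.posSemidef_smul_one_sub {n : Type*} [Fintype n] [DecidableEq n]
    {A : Matrix n n ℝ} (hA : A.IsHermitian) {c : ℝ} (hc : ∀ i, hA.eigenvalues i ≤ c) :
    (c • (1 : Matrix n n ℝ) - A).PosSemidef := by
  have h : A ≤ algebraMap ℝ (Matrix n n ℝ) c := by
    refine le_algebraMap_of_spectrum_le (fun x hx => ?_) hA
    rw [hA.spectrum_real_eq_range_eigenvalues] at hx
    obtain ⟨i, rfl⟩ := hx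
    exact hc i
  rwa [Matrix.le_iff, Algebra.algebraMap_eq_smul_one] at h

open scoped Kronecker in
theorem Matrix.PosSemidef.sq_smul_one_sub_kronecker {n : Type*} [Fintype n] [DecidableEq n]
    {A : Matrix n n ℝ} (hA : A.PosSemidef) {c : ℝ} (hc : 0 ≤ c)
    (h : (c • (1 : Matrix n n ℝ) - A).PosSemidef) :
    (c ^ 2 • (1 : Matrix (n × n) (n × n) ℝ) - A ⊗ₖ A).PosSemidef := by
  have h1 := ((PosSemidef.one (n := n) (R := ℝ)).smul hc).kronecker h
  have h2 := h.kronecker hA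
  have e : c ^ 2 • (1 : Matrix (n × n) (n × n) ℝ) - A ⊗ₖ A =
      (c • (1 : Matrix n n ℝ)) ⊗ₖ (c • (1 : Matrix n n ℝ) - A) +
        (c • (1 : Matrix n n ℝ) - A) ⊗ₖ A := by
    rw [← one_kronecker_one]
    ext p q
    simp only [sub_apply, add_apply, smul_apply, kroneckerMap_apply, smul_eq_mul]
    ring
  rw [e]
  exact h1.add h2

theorem Matrix.PosSemidef.dotProduct_mulVec_le {n : Type*} [Fintype n] [DecidableEq n]
    {A : Matrix n n ℝ} {c : ℝ} (h : (c • (1 : Matrix n n ℝ) - A).PosSemidef) (x : n → ℝ) :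
    x ⬝ᵥ A *ᵥ x ≤ c * (x ⬝ᵥ x) := by
  have := h.dotProduct_mulVec_nonneg x
  simp only [star_trivial, sub_mulVec, smul_mulVec, one_mulVec, dotProduct_sub,
    dotProduct_smul, smul_eq_mul] at this
  linarith

theorem Mmat_eq_mul {d : ℕ} (μ : Fin d → ℝ) (A : Matrix (Fin d) (Fin d) ℝ) :
    Mmat μ A = Mmat μ 1 * A := by
  ext p k
  simp [Mmat, Matrix.mul_apply, Matrix.one_apply, add_mul, Finset.sum_add_distrib]
  ring

theorem Bmat_eq_mul {d : ℕ} (μ : Fin d → ℝ) (A : Matrix (Fin d) (Fin d) ℝ) :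
    Bmat μ A = Mmat μ 1 * A * (Mmat μ 1)ᵀ := by
  rw [← Mmat_eq_mul]
  ext p q
  simp [Mmat, Bmat, Matrix.mul_apply, Matrix.one_apply, mul_add, Finset.sum_add_distrib]
  ring

open scoped Kronecker in
theorem Qmat_eq {d : ℕ} (μ : Fin d → ℝ) (A : Matrix (Fin d) (Fin d) ℝ) :
    Qmat μ A = (1 / 2 : ℝ) • (A ⊗ₖ A) + (1 / 4 : ℝ) • Bmat μ A := by
  ext p q
  simp [Qmat, kroneckerMap_apply, mul_assoc]

theorem Mmat_one_transpose_mulVec {d : ℕ} (μ : Fin d → ℝ) (y : Fin d × Fin d → ℝ) (j : Fin d) :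
    ((Mmat μ 1)ᵀ *ᵥ y) j = ∑ i, μ i * (y (i, j) + y (j, i)) := by
  simp [mulVec, dotProduct, Mmat, Matrix.one_apply, Fintype.sum_prod_type, add_mul, mul_add,
    Finset.sum_add_distrib]

theorem Mmat_one_transpose_mulVec_dotProduct_self_le {d : ℕ} (μ : Fin d → ℝ)
    (y : Fin d × Fin d → ℝ) :
    ((Mmat μ 1)ᵀ *ᵥ y) ⬝ᵥ ((Mmat μ 1)ᵀ *ᵥ y) ≤ 4 * (∑ i, μ i ^ 2) * (y ⬝ᵥ y) := by
  have key : ∀ j, ((Mmat μ 1)ᵀ *ᵥ y) j * ((Mmat μ 1)ᵀ *ᵥ y) j ≤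
      (∑ i, μ i ^ 2) * ∑ i, 2 * (y (i, j) ^ 2 + y (j, i) ^ 2) := fun j => by
    rw [Mmat_one_transpose_mulVec, ← pow_two]
    refine (Finset.sum_mul_sq_le_sq_mul_sq _ _ _).trans ?_
    gcongr with i
    nlinarith [sq_nonneg (y (i, j) - y (j, i))]
  refine (Finset.sum_le_sum fun j _ => key j).trans (le_of_eq ?_)
  have hy : y ⬝ᵥ y = ∑ j, ∑ i, y (j, i) ^ 2 := by
    simp [dotProduct, Fintype.sum_prod_type, pow_two]
  have hy' : ∑ j, ∑ i, y (i, j) ^ 2 = y ⬝ᵥ y := by rw [hy, Finset.sum_comm]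
  simp only [← Finset.mul_sum, Finset.sum_add_distrib]
  rw [hy', ← hy]
  ring

theorem stmt15 {d : ℕ} (A : Matrix (Fin d) (Fin d) ℝ) (hA : A.PosDef) (μ : Fin d → ℝ)
    (lmax : ℝ) (hmax : IsGreatest (Set.range hA.1.eigenvalues) lmax) :
    ((7 * (1 + ∑ i, μ i ^ 2) * max lmax (lmax ^ 2)) •
          (1 : Matrix (Fin d ⊕ Fin d × Fin d) (Fin d ⊕ Fin d × Fin d) ℝ) -
        Matrix.fromBlocks A (-((1 / 2 : ℝ) • (Mmat μ A)ᵀ)) (-((1 / 2 : ℝ) • Mmat μ A))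
          (Qmat μ A)).PosSemidef := by
  have hsymm : Aᵀ = A := by simpa using hA.1.eq
  obtain ⟨⟨i₀, hi₀⟩, hub⟩ := hmax
  have hpos : 0 < lmax := hi₀ ▸ hA.eigenvalues_pos i₀
  have hle : (lmax • (1 : Matrix (Fin d) (Fin d) ℝ) - A).PosSemidef :=
    hA.1.posSemidef_smul_one_sub fun i => hub ⟨i, rfl⟩
  have hkron := hA.posSemidef.sq_smul_one_sub_kronecker hpos.le hle
  have hB : (Bmat μ A)ᵀ = Bmat μ A := by
    simp [Bmat_eq_mul, transpose_mul, hsymm, Matrix.mul_assoc]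
  have hQ : (Qmat μ A)ᵀ = Qmat μ A := by
    simp only [Qmat_eq, transpose_add, transpose_smul, hB]
    rw [← kroneckerMap_transpose, hsymm]
  refine .of_dotProduct_mulVec_nonneg ?_ fun v => ?_
  · simp [IsHermitian, conjTranspose_eq_transpose_of_trivial, fromBlocks_transpose, hQ, hsymm]
  obtain ⟨x, y, rfl⟩ : ∃ x y, v = Sum.elim x y := ⟨v ∘ Sum.inl, v ∘ Sum.inr, by simp⟩
  set w := (Mmat μ 1)ᵀ *ᵥ y with hw
  have hMx : y ⬝ᵥ Mmat μ A *ᵥ x = w ⬝ᵥ A *ᵥ x := by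
    rw [Mmat_eq_mul, ← mulVec_mulVec, dotProduct_mulVec, ← mulVec_transpose]
  have hMy : (Mmat μ A)ᵀ *ᵥ y = A *ᵥ w := by
    rw [Mmat_eq_mul, transpose_mul, hsymm, ← mulVec_mulVec]
  have hBy : y ⬝ᵥ Bmat μ A *ᵥ y = w ⬝ᵥ A *ᵥ w := by
    rw [Bmat_eq_mul, ← mulVec_mulVec, ← mulVec_mulVec, dotProduct_mulVec, ← mulVec_transpose]
  have h1 := hle.dotProduct_mulVec_le (x - (1 / 2 : ℝ) • w)
  have h2 := hkron.dotProduct_mulVec_le y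
  have h3 := Mmat_one_transpose_mulVec_dotProduct_self_le μ y
  rw [← hw] at h3
  have h4 : 0 ≤ (x + (1 / 2 : ℝ) • w) ⬝ᵥ (x + (1 / 2 : ℝ) • w) := by
    simpa using dotProduct_star_self_nonneg (x + (1 / 2 : ℝ) • w)
  have hx : 0 ≤ x ⬝ᵥ x := by simpa using dotProduct_star_self_nonneg x
  have hy : 0 ≤ y ⬝ᵥ y := by simpa using dotProduct_star_self_nonneg y
  have hμ : 0 ≤ ∑ i, μ i ^ 2 := Finset.sum_nonneg fun i _ => sq_nonneg _
  simp only [star_trivial, sub_mulVec, smul_mulVec, one_mulVec, fromBlocks_mulVec,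
    dotProduct_sub, dotProduct_smul, smul_eq_mul, sumElim_dotProduct_sumElim, neg_mulVec,
    Sum.elim_comp_inl, Sum.elim_comp_inr, Qmat_eq, add_mulVec, dotProduct_add, dotProduct_neg,
    hMx, hMy, hBy]
  simp only [mulVec_sub, mulVec_smul, sub_dotProduct, dotProduct_sub, smul_dotProduct,
    dotProduct_smul, add_dotProduct, dotProduct_add, smul_eq_mul, dotProduct_comm w x] at h1 h4
  set m := ∑ i, μ i ^ 2
  set K := max lmax (lmax ^ 2)
  have hK1 : lmax ≤ K := le_max_left _ _
  have hK2 : lmax ^ 2 ≤ K := le_max_right _ _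
  have hK : 0 ≤ K := hpos.le.trans hK1
  have h5 : lmax * (2 * (x ⬝ᵥ x) + 2 * m * (y ⬝ᵥ y)) ≤ K * (2 * (x ⬝ᵥ x) + 2 * m * (y ⬝ᵥ y)) := by
    gcongr
  have h6 : lmax ^ 2 * (y ⬝ᵥ y) ≤ K * (y ⬝ᵥ y) := by gcongr
  have h7 : lmax * (x ⬝ᵥ x - x ⬝ᵥ w + (1 / 4) * (w ⬝ᵥ w)) ≤
      lmax * (2 * (x ⬝ᵥ x) + 2 * m * (y ⬝ᵥ y)) :=
    mul_le_mul_of_nonneg_left (by linarith) hpos.le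
  have h8 : 0 ≤ K * (m * (x ⬝ᵥ x)) := by positivity
  have h9 : 0 ≤ K * (m * (y ⬝ᵥ y)) := by positivity
  have h10 : 0 ≤ K * (x ⬝ᵥ x) := by positivity
  have h11 : 0 ≤ K * (y ⬝ᵥ y) := by positivity
  linarith
end
end

section
/- Let (Ω, 𝔉, ℙ) be a probability space and X : Ω → ℝ a random variable whose law is the exponential distribution with rate a > 0. Let S ∈ 𝔉 be an event with ℙ(S) ≥ α for some α ∈ (0,1]. Then the conditional mean of X given S satisfies (α/2)·(1/a) ≤ E[X·1_S]/ℙ(S) ≤ (1 + log(1/α))·(1/a). -/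
open MeasureTheory ProbabilityTheory Real

lemma tendsto_exponential_tail_antideriv (a t : ℝ) (ha : 0 < a) :
    Filter.Tendsto (fun x : ℝ => -((x - t + 1 / a) * rexp (-(a * x)))) Filter.atTop (nhds 0) := by
  have h1 : Filter.Tendsto (fun x : ℝ => x * rexp (-(a * x))) Filter.atTop (nhds 0) := by
    simpa using tendsto_rpow_mul_exp_neg_mul_atTop_nhds_zero 1 a ha
  have h0 : Filter.Tendsto (fun x : ℝ => rexp (-(a * x))) Filter.atTop (nhds 0) := by
    simpa using tendsto_rpow_mul_exp_neg_mul_atTop_nhds_zero 0 a ha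
  have h := (h1.add (h0.const_mul (1 / a - t))).neg
  simp only [mul_zero, add_zero, neg_zero] at h
  refine h.congr fun x => ?_
  ring

lemma hasDerivAt_exponential_tail_antideriv (a t x : ℝ) (ha : 0 < a) :
    HasDerivAt (fun x : ℝ => -((x - t + 1 / a) * rexp (-(a * x))))
      (a * rexp (-(a * x)) * (x - t)) x := by
  have h1 : HasDerivAt (fun x : ℝ => x - t + 1 / a) 1 x :=
    ((hasDerivAt_id x).sub_const t).add_const (1 / a)
  have h2 : HasDerivAt (fun x : ℝ => rexp (-(a * x))) (rexp (-(a * x)) * (-(a * 1))) x :=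
    (((hasDerivAt_id x).const_mul a).neg).exp
  refine ((h1.mul h2).neg).congr_deriv ?_
  field_simp
  ring

lemma exponentialPDF_toReal_smul_posPart (a t : ℝ) (ha : 0 < a) (ht : 0 ≤ t) :
    (fun x => (gammaPDF 1 a x).toReal • max (x - t) 0) =
      (Set.Ioi t).indicator (fun x => a * rexp (-(a * x)) * (x - t)) := by
  ext x
  have hpdf := exponentialPDF_eq a x
  rw [exponentialPDF, exponentialPDFReal] at hpdf
  rw [gammaPDF, hpdf]
  by_cases hx : t < x
  · have hx0 : 0 ≤ x := ht.trans hx.le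
    rw [Set.indicator_of_mem (Set.mem_Ioi.2 hx), if_pos hx0, max_eq_left (by linarith),
      ENNReal.toReal_ofReal (by positivity), smul_eq_mul]
  · rw [Set.indicator_of_notMem (by simpa using hx), max_eq_right (by linarith), smul_zero]

lemma integrable_posPart_sub_expMeasure (a t : ℝ) (ha : 0 < a) (ht : 0 ≤ t) :
    Integrable (fun x => max (x - t) 0) (expMeasure a) := by
  rw [expMeasure, gammaMeasure, integrable_withDensity_iff_integrable_smul'
      (show Measurable (gammaPDF 1 a) from (measurable_gammaPDFReal 1 a).ennreal_ofReal) (by simp [gammaPDF]),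
    exponentialPDF_toReal_smul_posPart a t ha ht, integrable_indicator_iff measurableSet_Ioi]
  exact integrableOn_Ioi_deriv_of_nonneg'
    (fun x _ => hasDerivAt_exponential_tail_antideriv a t x ha)
    (fun x hx => mul_nonneg (by positivity) (sub_nonneg.2 (Set.mem_Ioi.1 hx).le))
    (tendsto_exponential_tail_antideriv a t ha)

lemma integral_posPart_sub_expMeasure (a t : ℝ) (ha : 0 < a) (ht : 0 ≤ t) :
    ∫ x, max (x - t) 0 ∂(expMeasure a) = rexp (-(a * t)) / a := by
  rw [expMeasure, gammaMeasure, integral_withDensity_eq_integral_toReal_smul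
      (show Measurable (gammaPDF 1 a) from (measurable_gammaPDFReal 1 a).ennreal_ofReal) (by simp [gammaPDF]),
    exponentialPDF_toReal_smul_posPart a t ha ht, integral_indicator measurableSet_Ioi,
    integral_Ioi_of_hasDerivAt_of_nonneg'
      (fun x _ => hasDerivAt_exponential_tail_antideriv a t x ha)
      (fun x hx => mul_nonneg (by positivity) (sub_nonneg.2 (Set.mem_Ioi.1 hx).le))
      (tendsto_exponential_tail_antideriv a t ha)]
  ring

lemma ae_nonneg_expMeasure (a : ℝ) : ∀ᵐ x ∂(expMeasure a), 0 ≤ x := by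
  rw [ae_iff]
  simp only [not_le]
  change expMeasure a (Set.Iio 0) = 0
  rw [expMeasure, gammaMeasure, withDensity_apply _ measurableSet_Iio]
  exact lintegral_exponentialPDF_of_nonpos le_rfl

lemma exp_neg_le_one_sub_add_sq_div_two (y : ℝ) (hy : 0 ≤ y) :
    rexp (-y) ≤ 1 - y + y ^ 2 / 2 := by
  rw [exp_neg, inv_le_iff_one_le_mul₀ (exp_pos y)]
  have h := quadratic_le_exp_of_nonneg hy
  have h1 : 0 ≤ 1 - y + y ^ 2 / 2 := by nlinarith [sq_nonneg (y - 1)]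
  nlinarith [mul_le_mul_of_nonneg_left h h1, sq_nonneg (y ^ 2)]

theorem stmt16 {Ω : Type*} [MeasurableSpace Ω] (μ : Measure Ω) [IsProbabilityMeasure μ]
    (X : Ω → ℝ) (hX : Measurable X) (a : ℝ) (ha : 0 < a)
    (hlaw : Measure.map X μ = expMeasure a)
    (S : Set Ω) (hS : MeasurableSet S)
    (α : ℝ) (hα : α ∈ Set.Ioc (0 : ℝ) 1) (hPS : α ≤ (μ S).toReal) :
    α / 2 * (1 / a) ≤ (∫ ω in S, X ω ∂μ) / (μ S).toReal ∧
      (∫ ω in S, X ω ∂μ) / (μ S).toReal ≤ (1 + Real.log (1 / α)) * (1 / a) := by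
  obtain ⟨hα0, hα1⟩ := hα
  have hintpos (t : ℝ) (ht : 0 ≤ t) : Integrable (fun ω => max (X ω - t) 0) μ := by
    have h := integrable_posPart_sub_expMeasure a t ha ht
    rw [← hlaw] at h
    exact h.comp_measurable hX
  have hpos (t : ℝ) (ht : 0 ≤ t) : ∫ ω, max (X ω - t) 0 ∂μ = rexp (-(a * t)) / a := by
    rw [← integral_posPart_sub_expMeasure a t ha ht, ← hlaw,
      integral_map hX.aemeasurable (by fun_prop)]
  have hnonneg : ∀ᵐ ω ∂μ, 0 ≤ X ω := by
    have h := ae_nonneg_expMeasure a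
    rw [← hlaw] at h
    exact ae_of_ae_map hX.aemeasurable h
  have hXmax : (fun ω => max (X ω - 0) 0) =ᵐ[μ] X := by
    filter_upwards [hnonneg] with ω hω
    simpa using hω
  have hint : Integrable X μ := (hintpos 0 le_rfl).congr hXmax
  have hmean : ∫ ω, X ω ∂μ = 1 / a := by
    rw [← integral_congr_ae hXmax, hpos 0 le_rfl]
    simp
  have hconst (t : ℝ) : ∫ _ in S, t ∂μ = (μ S).toReal * t := by
    simp [Measure.real]
  set p := (μ S).toReal
  have hp0 : 0 < p := hα0.trans_le hPS
  constructor
  · have ht : 0 ≤ p / a := by positivity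
    have hi := hintpos (p / a) ht
    have hi' : Integrable (fun ω => p / a - X ω + max (X ω - p / a) 0) μ :=
      ((integrable_const _).sub hint).add hi
    have hle : ∫ ω in S, (p / a - X ω) ∂μ ≤ ∫ ω, (p / a - X ω + max (X ω - p / a) 0) ∂μ := by
      calc _ ≤ ∫ ω in S, (p / a - X ω + max (X ω - p / a) 0) ∂μ :=
            integral_mono ((integrable_const _).sub hint).integrableOn hi'.integrableOn
              fun ω => le_add_of_nonneg_right (le_max_right _ _)
        _ ≤ _ := setIntegral_le_integral hi' (Filter.Eventually.of_forall fun ω => by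
            have := le_max_left (X ω - p / a) 0
            simp only [Pi.zero_apply]
            linarith)
    rw [integral_sub (integrable_const _) hint.integrableOn, hconst,
      integral_add (f := fun ω => p / a - X ω) ((integrable_const _).sub hint) hi, integral_sub (integrable_const _) hint,
      hmean, hpos _ ht, mul_div_cancel₀ _ ha.ne'] at hle
    simp only [integral_const, probReal_univ, one_smul] at hle
    have hexp := div_le_div_of_nonneg_right (exp_neg_le_one_sub_add_sq_div_two p hp0.le) ha.le
    rw [le_div_iff₀ hp0]
    have h2 : α / 2 * (1 / a) * p ≤ p / 2 * (1 / a) * p := by gcongr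
    have h3 : (1 - p + p ^ 2 / 2) / a = 1 / a - p / a + p / 2 * (1 / a) * p := by ring
    have h4 : p * (p / a) = 2 * (p / 2 * (1 / a) * p) := by ring
    linarith
  · have hlog : 0 ≤ Real.log (1 / α) := Real.log_nonneg (by rw [le_div_iff₀ hα0]; linarith)
    have ht : 0 ≤ Real.log (1 / α) / a := by positivity
    have hi := hintpos _ ht
    have hle : ∫ ω in S, X ω ∂μ ≤
        ∫ ω in S, (Real.log (1 / α) / a + max (X ω - Real.log (1 / α) / a) 0) ∂μ :=
      integral_mono hint.integrableOn ((integrable_const _).add hi).integrableOn fun ω => by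
        have := le_max_left (X ω - Real.log (1 / α) / a) 0
        simp only
        linarith
    rw [integral_add (integrable_const _) hi.integrableOn, hconst] at hle
    have htail := setIntegral_le_integral (s := S) hi
      (Filter.Eventually.of_forall fun ω => le_max_right _ _)
    have hexp : rexp (-Real.log (1 / α)) = α := by
      rw [one_div, Real.log_inv, neg_neg, Real.exp_log hα0]
    rw [hpos _ ht, mul_div_cancel₀ _ ha.ne', hexp] at htail
    rw [div_le_iff₀ hp0]
    have h2 : α / a ≤ p / a := by gcongr
    have h3 : (1 + Real.log (1 / α)) * (1 / a) * p = p * (Real.log (1 / α) / a) + p / a := by ring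
    linarith
end

section
/- Let a ≥ c > 0 be rates of exponential distributions. Then 3a − 2c > 0, the integral ∫₀^∞ (a·e^{−a·x})³ / (c·e^{−c·x})² dx equals a³/(c²·(3a − 2c)), and the order-3 Rényi divergence from the rate-c exponential distribution to the rate-a exponential distribution, namely R₃ := (1/2)·log( a³/(c²·(3a − 2c)) ), satisfies R₃ ≤ (3/2)·(a/c − 1)². -/
open MeasureTheory Real

theorem integral_exp_density_cube_div_sq (a c : ℝ) (hc : c ≠ 0) (h : 0 < 3 * a - 2 * c) :
    (∫ x in Set.Ioi (0 : ℝ), (a * exp (-(a * x))) ^ 3 / (c * exp (-(c * x))) ^ 2) =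
      a ^ 3 / (c ^ 2 * (3 * a - 2 * c)) := by
  have hfun : ∀ x : ℝ, (a * exp (-(a * x))) ^ 3 / (c * exp (-(c * x))) ^ 2 =
      a ^ 3 / c ^ 2 * exp (-(3 * a - 2 * c) * x) := by
    intro x
    rw [mul_pow, mul_pow, mul_div_mul_comm, ← exp_nat_mul, ← exp_nat_mul, ← exp_sub]
    congr 2
    push_cast
    ring
  simp_rw [hfun]
  rw [integral_const_mul, integral_exp_mul_Ioi (neg_lt_zero.mpr h)]
  simp only [mul_zero, exp_zero]
  field_simp

theorem log_cube_div_le {r : ℝ} (hr : 1 ≤ r) :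
    log (r ^ 3 / (3 * r - 2)) ≤ 3 * (r - 1) ^ 2 := by
  have hd : 0 < 3 * r - 2 := by linarith
  have hbound : r ^ 3 / (3 * r - 2) ≤ 3 * (r - 1) ^ 2 + 1 := by
    rw [div_le_iff₀ hd]
    nlinarith [pow_nonneg (sub_nonneg.mpr hr) 3]
  linarith [log_le_sub_one_of_pos (show 0 < r ^ 3 / (3 * r - 2) by positivity)]

theorem stmt17 (a c : ℝ) (hc : 0 < c) (hac : c ≤ a) :
    0 < 3 * a - 2 * c ∧
      (∫ x in Set.Ioi (0 : ℝ),
          (a * Real.exp (-(a * x))) ^ 3 / (c * Real.exp (-(c * x))) ^ 2) =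
        a ^ 3 / (c ^ 2 * (3 * a - 2 * c)) ∧
      1 / 2 * Real.log (a ^ 3 / (c ^ 2 * (3 * a - 2 * c))) ≤ 3 / 2 * (a / c - 1) ^ 2 := by
  have h : 0 < 3 * a - 2 * c := by linarith
  refine ⟨h, integral_exp_density_cube_div_sq a c hc.ne' h, ?_⟩
  have hratio : a ^ 3 / (c ^ 2 * (3 * a - 2 * c)) = (a / c) ^ 3 / (3 * (a / c) - 2) := by
    have hd : 3 * (a / c) - 2 = (3 * a - 2 * c) / c := by field_simp
    rw [hd]
    field_simp
  rw [hratio]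
  linarith [log_cube_div_le ((one_le_div hc).mpr hac)]
end

section
/- Let μ ∈ ℝ, let λ > 0 and b > 0 be variances, and let q ≥ 1 be a real number with q·b − (q−1)·λ > 0. Let p be the Lebesgue density of the Gaussian distribution N(μ, λ) (mean μ, variance λ) and g the Lebesgue density of N(0, b). Then ∫_ℝ p(x)^q · g(x)^{1−q} dx = √( b^q / ( λ^{q−1} · (q·b − (q−1)·λ) ) ) · exp( (q·(q−1)/2) · μ² / (q·b − (q−1)·λ) ). -/
open MeasureTheory Real

noncomputable section

/-- The Lebesgue density of the Gaussian distribution `N(m, v)` on `ℝ`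
with mean `m` and variance `v > 0`. -/
noncomputable def gaussDensity (m v x : ℝ) : ℝ :=
  (2 * Real.pi * v) ^ (-(1 / 2) : ℝ) * Real.exp (-(x - m) ^ 2 / (2 * v))

theorem gaussDensity_rpow {v : ℝ} (hv : 0 < v) (m r x : ℝ) :
    gaussDensity m v x ^ r =
      (2 * π * v) ^ (-(r / 2)) * Real.exp (r * (-(x - m) ^ 2 / (2 * v))) := by
  rw [gaussDensity, Real.mul_rpow (by positivity) (by positivity),
    ← Real.rpow_mul (by positivity), ← Real.exp_mul]
  ring_nf

/-- The exponent of `p ^ q * g ^ (1 - q)`, with the square completed. -/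
theorem gaussian_exponent_complete_square {lam b q : ℝ} (hlam : lam ≠ 0) (hb : b ≠ 0)
    (hD : q * b - (q - 1) * lam ≠ 0) (μ x : ℝ) :
    q * (-(x - μ) ^ 2 / (2 * lam)) + (1 - q) * (-(x - 0) ^ 2 / (2 * b)) =
      q * (q - 1) / 2 * μ ^ 2 / (q * b - (q - 1) * lam) +
        -((q * b - (q - 1) * lam) / (2 * lam * b)) *
          (x - q * b * μ / (q * b - (q - 1) * lam)) ^ 2 := by
  generalize hd : q * b - (q - 1) * lam = D at hD ⊢
  field_simp
  subst hd
  ring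

theorem gaussian_prefactor {lam b D : ℝ} (hlam : 0 < lam) (hb : 0 < b) (hD : 0 < D) (q : ℝ) :
    (2 * π * lam) ^ (-(q / 2)) * (2 * π * b) ^ (-((1 - q) / 2)) * √(π / (D / (2 * lam * b))) =
      √(b ^ q / (lam ^ (q - 1) * D)) := by
  have hpi := Real.pi_pos
  apply Real.log_injOn_pos (Set.mem_Ioi.2 (by positivity)) (Set.mem_Ioi.2 (by positivity))
  rw [Real.log_mul (by positivity) (by positivity), Real.log_mul (by positivity) (by positivity),
    Real.log_sqrt (by positivity), Real.log_sqrt (by positivity),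
    Real.log_rpow (by positivity), Real.log_rpow (by positivity),
    Real.log_div (by positivity) (by positivity), Real.log_div (by positivity) (by positivity),
    Real.log_div (by positivity) (by positivity), Real.log_rpow hb,
    Real.log_mul (x := lam ^ (q - 1)) (by positivity) (by positivity), Real.log_rpow hlam,
    Real.log_mul (x := 2 * π) (by positivity) (by positivity),
    Real.log_mul (x := 2 * π) (by positivity) (by positivity),
    Real.log_mul (x := 2 * lam) (by positivity) (by positivity),
    Real.log_mul (x := 2) (by positivity) (by positivity),
    Real.log_mul (x := 2) (by positivity) (by positivity)]
  ring

theorem stmt18 (μ lam b : ℝ) (hlam : 0 < lam) (hb : 0 < b)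
    (q : ℝ) (hq : 1 ≤ q) (hpos : 0 < q * b - (q - 1) * lam) :
    (∫ x : ℝ, gaussDensity μ lam x ^ q * gaussDensity 0 b x ^ (1 - q)) =
      Real.sqrt (b ^ q / (lam ^ (q - 1) * (q * b - (q - 1) * lam))) *
        Real.exp (q * (q - 1) / 2 * μ ^ 2 / (q * b - (q - 1) * lam)) := by
  have hint : ∀ x : ℝ, gaussDensity μ lam x ^ q * gaussDensity 0 b x ^ (1 - q) =
      (2 * π * lam) ^ (-(q / 2)) * (2 * π * b) ^ (-((1 - q) / 2)) *
        Real.exp (q * (q - 1) / 2 * μ ^ 2 / (q * b - (q - 1) * lam)) *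
          Real.exp (-((q * b - (q - 1) * lam) / (2 * lam * b)) *
            (x - q * b * μ / (q * b - (q - 1) * lam)) ^ 2) := fun x => by
    rw [gaussDensity_rpow hlam, gaussDensity_rpow hb, mul_mul_mul_comm, ← Real.exp_add,
      gaussian_exponent_complete_square hlam.ne' hb.ne' hpos.ne', Real.exp_add, mul_assoc _ (rexp _)]
  simp_rw [hint]
  rw [integral_const_mul, integral_sub_right_eq_self
    (fun x : ℝ => Real.exp (-((q * b - (q - 1) * lam) / (2 * lam * b)) * x ^ 2)),
    integral_gaussian, ← gaussian_prefactor hlam hb hpos q]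
  ring
end
end

section
/- The following two real inequalities hold: (i) for every q ∈ [1,3] and every x ∈ (0,1), log( 1 / ( x^{q−1} · (q − (q−1)·x) ) ) ≤ q·(1 − 1/x)²; and (ii) for every q ∈ [0,3] and every x ≥ 1, log( x^q / (q·x − (q−1)) ) ≤ q·x·(1 − 1/x)². (In both cases the argument of the logarithm is positive: q − (q−1)·x > 0 for x ∈ (0,1) and q ≥ 1, and q·x − (q−1) ≥ 1 for x ≥ 1 and q ≥ 0.) -/
open Real

theorem sub_mul_pos_of_le_one {q x : ℝ} (hq : 1 ≤ q) (hx : x ≤ 1) :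
    0 < q - (q - 1) * x := by
  nlinarith [mul_nonneg (sub_nonneg.2 hq) (sub_nonneg.2 hx)]

theorem one_le_mul_sub {q x : ℝ} (hq : 0 ≤ q) (hx : 1 ≤ x) : 1 ≤ q * x - (q - 1) := by
  nlinarith [mul_nonneg hq (sub_nonneg.2 hx)]

theorem chiSq_bridge_nonneg_of_le_one {q : ℝ} (hq : 1 ≤ q) (hq3 : q ≤ 3) {x : ℝ}
    (hx : 0 < x) (hx1 : x ≤ 1) :
    0 ≤ q * (1 - x⁻¹) ^ 2 + (q - 1) * log x + log (q - (q - 1) * x) := by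
  have hd : ∀ y : ℝ, 0 < y → y ≤ 1 →
      HasDerivAt (fun y : ℝ => q * (1 - y⁻¹) ^ 2 + (q - 1) * log y + log (q - (q - 1) * y))
        (-(q * (1 - y) * (2 * (q - (q - 1) * y) - (q - 1) * y ^ 2) /
          (y ^ 3 * (q - (q - 1) * y)))) y := by
    intro y hy hy1
    have hD := sub_mul_pos_of_le_one hq hy1
    have h := (((((hasDerivAt_inv hy.ne').const_sub 1).pow 2).const_mul q).add
      ((hasDerivAt_log hy.ne').const_mul (q - 1))).add
      ((((hasDerivAt_id y).const_mul (q - 1)).const_sub q).log hD.ne')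
    refine h.congr_deriv ?_
    have hD' := hD.ne'
    simp only [id, Nat.cast_ofNat, Nat.add_one_sub_one, pow_one, mul_one]
    generalize hDe : q - (q - 1) * y = D at hD' ⊢
    field_simp
    rw [← hDe]
    ring
  have hanti : AntitoneOn
      (fun y : ℝ => q * (1 - y⁻¹) ^ 2 + (q - 1) * log y + log (q - (q - 1) * y))
      (Set.Icc x 1) := by
    refine antitoneOn_of_deriv_nonpos (convex_Icc x 1)
      (fun y hy => (hd y (hx.trans_le hy.1) hy.2).continuousAt.continuousWithinAt)
      (fun y hy => ?_) (fun y hy => ?_) <;> rw [interior_Icc] at hy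
    · exact (hd y (hx.trans hy.1) hy.2.le).differentiableAt.differentiableWithinAt
    · have hy0 := hx.trans hy.1
      have hD := sub_mul_pos_of_le_one hq hy.2.le
      rw [(hd y hy0 hy.2.le).deriv, neg_nonpos]
      have hy1 : 0 ≤ 1 - y := sub_nonneg.2 hy.2.le
      have hk : 0 ≤ 2 * (q - (q - 1) * y) - (q - 1) * y ^ 2 := by
        have h1 : (q - 1) * y ^ 2 ≤ 2 * 1 :=
          mul_le_mul (by linarith) (by nlinarith) (sq_nonneg y) (by norm_num)
        nlinarith [mul_nonneg (sub_nonneg.2 hq) hy1]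
      positivity
  simpa using hanti ⟨le_rfl, hx1⟩ ⟨hx1, le_rfl⟩ hx1

theorem chiSq_bridge_nonneg_of_one_le {q : ℝ} (hq : 0 ≤ q) (hq3 : q ≤ 3) {x : ℝ}
    (hx : 1 ≤ x) :
    0 ≤ q * (x - 2 + x⁻¹) - q * log x + log (q * x - (q - 1)) := by
  have hd : ∀ y : ℝ, 1 ≤ y →
      HasDerivAt (fun y : ℝ => q * (y - 2 + y⁻¹) - q * log y + log (q * y - (q - 1)))
        (q * (y - 1) * (2 * y + 1 + q * (y ^ 2 - y - 1)) /
          (y ^ 2 * (q * y - (q - 1)))) y := by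
    intro y hy
    have hy0 : 0 < y := one_pos.trans_le hy
    have hD : 0 < q * y - (q - 1) := one_pos.trans_le (one_le_mul_sub hq hy)
    have h := (((((hasDerivAt_id y).sub_const 2).add (hasDerivAt_inv hy0.ne')).const_mul q).sub
      ((hasDerivAt_log hy0.ne').const_mul q)).add
      ((((hasDerivAt_id y).const_mul q).sub_const (q - 1)).log hD.ne')
    refine h.congr_deriv ?_
    have hD' := hD.ne'
    simp only [id]
    field_simp
    ring
  have hmono : MonotoneOn
      (fun y : ℝ => q * (y - 2 + y⁻¹) - q * log y + log (q * y - (q - 1)))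
      (Set.Icc 1 x) := by
    refine monotoneOn_of_deriv_nonneg (convex_Icc 1 x)
      (fun y hy => (hd y hy.1).continuousAt.continuousWithinAt)
      (fun y hy => ?_) (fun y hy => ?_) <;> rw [interior_Icc] at hy
    · exact (hd y hy.1.le).differentiableAt.differentiableWithinAt
    · have hD : 0 < q * y - (q - 1) := one_pos.trans_le (one_le_mul_sub hq hy.1.le)
      rw [(hd y hy.1.le).deriv]
      have hy1 : 0 ≤ y - 1 := sub_nonneg.2 hy.1.le
      have hk : 0 ≤ 2 * y + 1 + q * (y ^ 2 - y - 1) := by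
        nlinarith [mul_nonneg hq (mul_nonneg hy1 (by linarith : 0 ≤ y))]
      positivity
  have h := hmono ⟨le_rfl, hx⟩ ⟨hx, le_rfl⟩ hx
  norm_num at h
  linarith

theorem stmt19 :
    (∀ q : ℝ, q ∈ Set.Icc (1 : ℝ) 3 → ∀ x : ℝ, x ∈ Set.Ioo (0 : ℝ) 1 →
      Real.log (1 / (x ^ (q - 1) * (q - (q - 1) * x))) ≤ q * (1 - 1 / x) ^ 2) ∧
    (∀ q : ℝ, q ∈ Set.Icc (0 : ℝ) 3 → ∀ x : ℝ, 1 ≤ x →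
      Real.log (x ^ q / (q * x - (q - 1))) ≤ q * x * (1 - 1 / x) ^ 2) ∧
    (∀ q : ℝ, 1 ≤ q → ∀ x : ℝ, x ∈ Set.Ioo (0 : ℝ) 1 → 0 < q - (q - 1) * x) ∧
    (∀ q : ℝ, 0 ≤ q → ∀ x : ℝ, 1 ≤ x → 1 ≤ q * x - (q - 1)) := by
  refine ⟨fun q hq x hx => ?_, fun q hq x hx => ?_,
    fun q hq x hx => sub_mul_pos_of_le_one hq hx.2.le, fun q hq x hx => one_le_mul_sub hq hx⟩
  · have h := chiSq_bridge_nonneg_of_le_one hq.1 hq.2 hx.1 hx.2.le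
    rw [one_div, log_inv, log_mul (rpow_pos_of_pos hx.1 _).ne'
      (sub_mul_pos_of_le_one hq.1 hx.2.le).ne', log_rpow hx.1, one_div]
    linarith
  · have h := chiSq_bridge_nonneg_of_one_le hq.1 hq.2 hx
    have hx0 : 0 < x := one_pos.trans_le hx
    rw [log_div (rpow_pos_of_pos hx0 _).ne'
      (one_pos.trans_le (one_le_mul_sub hq.1 hx)).ne', log_rpow hx0]
    have he : q * x * (1 - 1 / x) ^ 2 = q * (x - 2 + x⁻¹) := by
      field_simp
      ring
    linarith
end
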